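/- arXiv:math/0111244 — 2 statements merged into one kernel-verified Lean document; each statement's English description precedes it below -/
import Mathlib

section
/- Let π: M → (ℂ²,0) be the blow-up at the origin, 𝓕 a foliation germ of multiplicity ν for which the exceptional divisor E is invariant under π*𝓕 (non-dicritical case). Then the sum over the singular points p of π*𝓕 on E of the Camacho–Sad indices I_p(π*𝓕, E) equals −1. -/
open Filter Topology

/-- The Taylor coefficient of `x^i y^j` of a function of two complex variables at the origin. -/
noncomputable def taylorCoeff (f : ℂ × ℂ → ℂ) (i j : ℕ) : ℂ :=
  iteratedDeriv i (fun x => iteratedDeriv j (fun y => f (x, y)) 0) 0 /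
    ((i.factorial : ℂ) * (j.factorial : ℂ))

/-- The Taylor series at `0` of a function of one complex variable. -/
noncomputable def taylor1 (f : ℂ → ℂ) : PowerSeries ℂ :=
  PowerSeries.mk fun n => iteratedDeriv n f 0 / (n.factorial : ℂ)

/-- The residue at `c` of the meromorphic germ `f/g` of one complex variable, computed as
the coefficient of `(z−c)⁻¹` of the quotient of Taylor series in the field of formal
Laurent series. -/
noncomputable def residueAt (c : ℂ) (f g : ℂ → ℂ) : ℂ :=
  (((HahnSeries.ofPowerSeries ℤ ℂ (taylor1 fun z => f (z + c)) : LaurentSeries ℂ) /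
    (HahnSeries.ofPowerSeries ℤ ℂ (taylor1 fun z => g (z + c)) : LaurentSeries ℂ)).coeff (-1))

section PartialDerivatives

open Finset.HasAntidiagonal (antidiagonal)

variable {f : ℂ × ℂ → ℂ}

theorem AnalyticAt.fderiv_apply_const {q : ℂ × ℂ} (hf : AnalyticAt ℂ f q) (w : ℂ × ℂ) :
    AnalyticAt ℂ (fun p => fderiv ℂ f p w) q :=
  (ContinuousLinearMap.apply ℂ ℂ w).analyticAt _ |>.comp hf.fderiv

/-- Directional derivatives of an analytic function commute. -/
theorem AnalyticAt.fderiv_fderiv_comm {q : ℂ × ℂ} (hf : AnalyticAt ℂ f q) (v w : ℂ × ℂ) :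
    fderiv ℂ (fun p => fderiv ℂ f p v) q w = fderiv ℂ (fun p => fderiv ℂ f p w) q v := by
  have h (u : ℂ × ℂ) : fderiv ℂ (fun p => fderiv ℂ f p u) q
      = (fderiv ℂ (fderiv ℂ f) q).flip u := by
    rw [fderiv_clm_apply hf.fderiv.differentiableAt (by fun_prop)]
    simp
  rw [h, h]
  exact (hf.contDiffAt (n := 2)).isSymmSndFDerivAt (by simp) w v

theorem AnalyticAt.deriv_slice_snd {x y : ℂ} (hf : AnalyticAt ℂ f (x, y)) :
    deriv (fun y => f (x, y)) y = fderiv ℂ f (x, y) (0, 1) := by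
  have h : HasDerivAt (fun y : ℂ => (x, y)) ((0 : ℂ), (1 : ℂ)) y :=
    (hasDerivAt_const y x).prodMk (hasDerivAt_id y)
  exact (hf.differentiableAt.hasFDerivAt.comp_hasDerivAt y h).deriv

theorem AnalyticAt.deriv_slice_fst {x y : ℂ} (hf : AnalyticAt ℂ f (x, y)) :
    deriv (fun x => f (x, y)) x = fderiv ℂ f (x, y) (1, 0) := by
  have h : HasDerivAt (fun x : ℂ => (x, y)) ((1 : ℂ), (0 : ℂ)) x :=
    (hasDerivAt_id x).prodMk (hasDerivAt_const x y)
  exact (hf.differentiableAt.hasFDerivAt.comp_hasDerivAt x h).deriv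

theorem eventually_eventually_slice {p : ℂ × ℂ → Prop} (h : ∀ᶠ q in 𝓝 (0 : ℂ × ℂ), p q) :
    ∀ᶠ x in 𝓝 (0 : ℂ), ∀ᶠ y in 𝓝 (0 : ℂ), p (x, y) := by
  rw [← Prod.mk_zero_zero, nhds_prod_eq] at h
  exact h.curry

theorem AnalyticAt.iteratedDeriv_succ_slice (hf : AnalyticAt ℂ f 0) (j : ℕ) :
    ∀ᶠ x in 𝓝 (0 : ℂ), iteratedDeriv (j + 1) (fun y => f (x, y)) 0
      = iteratedDeriv j (fun y => fderiv ℂ f (x, y) (0, 1)) 0 := by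
  filter_upwards [eventually_eventually_slice hf.eventually_analyticAt] with x hx
  rw [iteratedDeriv_succ']
  apply Filter.EventuallyEq.iteratedDeriv_eq
  filter_upwards [hx] with y hy using hy.deriv_slice_snd

theorem AnalyticAt.deriv_iteratedDeriv_slice (hf : AnalyticAt ℂ f 0) (j : ℕ) :
    ∀ᶠ x in 𝓝 (0 : ℂ), deriv (fun x => iteratedDeriv j (fun y => f (x, y)) 0) x
      = iteratedDeriv j (fun y => fderiv ℂ f (x, y) (1, 0)) 0 := by
  induction j generalizing f with
  | zero =>
    filter_upwards [eventually_eventually_slice hf.eventually_analyticAt] with x hx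
    simpa using hx.self_of_nhds.deriv_slice_fst
  | succ j ih =>
    filter_upwards [(hf.iteratedDeriv_succ_slice j).eventually_nhds,
      ih (hf.fderiv_apply_const (0, 1)),
      (hf.fderiv_apply_const (1, 0)).iteratedDeriv_succ_slice j,
      eventually_eventually_slice hf.eventually_analyticAt] with x hx hih hx' hcomm
    rw [hx', Filter.EventuallyEq.deriv_eq hx, hih]
    apply Filter.EventuallyEq.iteratedDeriv_eq
    filter_upwards [hcomm] with y hy using hy.fderiv_fderiv_comm _ _

theorem taylorCoeff_fderiv_snd (hf : AnalyticAt ℂ f 0) (i j : ℕ) :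
    taylorCoeff (fun q => fderiv ℂ f q (0, 1)) i j = (j + 1) * taylorCoeff f i (j + 1) := by
  have h : (fun x => iteratedDeriv (j + 1) (fun y => f (x, y)) 0)
      =ᶠ[𝓝 0] fun x => iteratedDeriv j (fun y => fderiv ℂ f (x, y) (0, 1)) 0 :=
    hf.iteratedDeriv_succ_slice j
  rw [taylorCoeff, taylorCoeff, h.iteratedDeriv_eq, Nat.factorial_succ]
  have := Nat.cast_add_one_ne_zero (R := ℂ) j
  have := Nat.cast_ne_zero (R := ℂ).2 j.factorial_ne_zero
  have := Nat.cast_ne_zero (R := ℂ).2 i.factorial_ne_zero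
  push_cast
  field_simp

theorem taylorCoeff_fderiv_fst (hf : AnalyticAt ℂ f 0) (i j : ℕ) :
    taylorCoeff (fun q => fderiv ℂ f q (1, 0)) i j = (i + 1) * taylorCoeff f (i + 1) j := by
  have h : deriv (fun x => iteratedDeriv j (fun y => f (x, y)) 0)
      =ᶠ[𝓝 0] fun x => iteratedDeriv j (fun y => fderiv ℂ f (x, y) (1, 0)) 0 :=
    hf.deriv_iteratedDeriv_slice j
  rw [taylorCoeff, taylorCoeff, iteratedDeriv_succ', h.iteratedDeriv_eq, Nat.factorial_succ]
  have := Nat.cast_add_one_ne_zero (R := ℂ) i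
  have := Nat.cast_ne_zero (R := ℂ).2 j.factorial_ne_zero
  have := Nat.cast_ne_zero (R := ℂ).2 i.factorial_ne_zero
  push_cast
  field_simp

/-- Euler's identity for the coefficients of a homogeneous form. -/
theorem sum_antidiagonal_euler (c : ℕ → ℕ → ℂ) (u v : ℂ) (n : ℕ) :
    u * ∑ p ∈ antidiagonal n, (p.1 + 1) * c (p.1 + 1) p.2 * u ^ p.1 * v ^ p.2 +
      v * ∑ p ∈ antidiagonal n, (p.2 + 1) * c p.1 (p.2 + 1) * u ^ p.1 * v ^ p.2 =
    (n + 1) * ∑ p ∈ antidiagonal (n + 1), c p.1 p.2 * u ^ p.1 * v ^ p.2 := by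
  have h₁ : ∑ p ∈ antidiagonal (n + 1), (p.1 : ℂ) * (c p.1 p.2 * u ^ p.1 * v ^ p.2) =
      u * ∑ p ∈ antidiagonal n, (p.1 + 1) * c (p.1 + 1) p.2 * u ^ p.1 * v ^ p.2 := by
    rw [Finset.Nat.sum_antidiagonal_succ, Finset.mul_sum]
    simp only [Nat.cast_zero, zero_mul, zero_add]
    refine Finset.sum_congr rfl fun p _ => ?_
    push_cast
    ring
  have h₂ : ∑ p ∈ antidiagonal (n + 1), (p.2 : ℂ) * (c p.1 p.2 * u ^ p.1 * v ^ p.2) =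
      v * ∑ p ∈ antidiagonal n, (p.2 + 1) * c p.1 (p.2 + 1) * u ^ p.1 * v ^ p.2 := by
    rw [Finset.Nat.sum_antidiagonal_succ', Finset.mul_sum]
    simp only [Nat.cast_zero, zero_mul, zero_add]
    refine Finset.sum_congr rfl fun p _ => ?_
    push_cast
    ring
  rw [← h₁, ← h₂, ← Finset.sum_add_distrib, Finset.mul_sum]
  refine Finset.sum_congr rfl fun p hp => ?_
  have : (p.1 : ℂ) + p.2 = n + 1 := by exact_mod_cast Finset.HasAntidiagonal.mem_antidiagonal.1 hp
  rw [← add_mul, this]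

/-- The Taylor coefficients of `f` along a complex line through the origin. -/
theorem iteratedDeriv_comp_line (hf : AnalyticAt ℂ f 0) (u v : ℂ) (n : ℕ) :
    iteratedDeriv n (fun x => f (x * u, x * v)) 0 =
      n.factorial * ∑ p ∈ antidiagonal n, taylorCoeff f p.1 p.2 * u ^ p.1 * v ^ p.2 := by
  induction n generalizing f with
  | zero => simp [taylorCoeff]
  | succ n ih =>
    have hline : AnalyticAt ℂ (fun x : ℂ => (x * u, x * v)) 0 := by fun_prop
    have hzero : ((0 : ℂ) * u, (0 : ℂ) * v) = 0 := by simp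
    have hcomp {g : ℂ × ℂ → ℂ} (hg : AnalyticAt ℂ g 0) :
        AnalyticAt ℂ (fun x => g (x * u, x * v)) 0 :=
      AnalyticAt.comp (by rwa [hzero]) hline
    have hderiv : deriv (fun x => f (x * u, x * v)) =ᶠ[𝓝 0] fun x =>
        u * fderiv ℂ f (x * u, x * v) (1, 0) + v * fderiv ℂ f (x * u, x * v) (0, 1) := by
      have htend : Tendsto (fun x : ℂ => (x * u, x * v)) (𝓝 0) (𝓝 0) := by
        simpa only [hzero] using hline.continuousAt.tendsto
      filter_upwards [htend.eventually hf.eventually_analyticAt] with x hx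
      have h : HasDerivAt (fun x : ℂ => (x * u, x * v)) (u, v) x :=
        (hasDerivAt_mul_const u).prodMk (hasDerivAt_mul_const v)
      have huv : (u, v) = u • ((1 : ℂ), (0 : ℂ)) + v • ((0 : ℂ), (1 : ℂ)) := by simp
      refine (hx.differentiableAt.hasFDerivAt.comp_hasDerivAt x h).deriv.trans ?_
      rw [huv, map_add, map_smul, map_smul, smul_eq_mul, smul_eq_mul]
    have h₁ := hf.fderiv_apply_const (1, 0)
    have h₂ := hf.fderiv_apply_const (0, 1)
    have hm₁ : AnalyticAt ℂ (fun x => u * fderiv ℂ f (x * u, x * v) (1, 0)) 0 :=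
      analyticAt_const.mul (hcomp h₁)
    have hm₂ : AnalyticAt ℂ (fun x => v * fderiv ℂ f (x * u, x * v) (0, 1)) 0 :=
      analyticAt_const.mul (hcomp h₂)
    rw [iteratedDeriv_succ', hderiv.iteratedDeriv_eq,
      iteratedDeriv_fun_add hm₁.contDiffAt hm₂.contDiffAt,
      iteratedDeriv_const_mul_field, iteratedDeriv_const_mul_field, ih h₁, ih h₂]
    simp only [taylorCoeff_fderiv_fst hf, taylorCoeff_fderiv_snd hf]
    have h := sum_antidiagonal_euler (taylorCoeff f) u v n
    rw [Nat.factorial_succ]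
    push_cast
    linear_combination (n.factorial : ℂ) * h

theorem iteratedDeriv_pow_mul_self {G : ℂ → ℂ} (hG : AnalyticAt ℂ G 0) (n : ℕ) :
    iteratedDeriv n (fun x => x ^ n * G x) 0 = n.factorial * G 0 := by
  rw [iteratedDeriv_fun_mul (by fun_prop) hG.contDiffAt, Finset.sum_range_succ,
    Finset.sum_eq_zero]
  · simp [Nat.descFactorial_self]
  · intro i hi
    simp [Nat.sub_ne_zero_of_lt (Finset.mem_range.1 hi)]

/-- If `f` restricted to the line spanned by `(u, v)` is `x ^ n * G x`, then `G 0` is the value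
at `(u, v)` of the homogeneous part of degree `n` of the Taylor expansion of `f`. -/
theorem eval_zero_eq_sum_taylorCoeff (hf : AnalyticAt ℂ f 0) {u v : ℂ} {n : ℕ} {G : ℂ → ℂ}
    (hG : AnalyticAt ℂ G 0) (h : ∀ᶠ x in 𝓝 (0 : ℂ), x ^ n * G x = f (x * u, x * v)) :
    G 0 = ∑ p ∈ antidiagonal n, taylorCoeff f p.1 p.2 * u ^ p.1 * v ^ p.2 := by
  have h₁ := iteratedDeriv_comp_line hf u v n
  rw [← Filter.EventuallyEq.iteratedDeriv_eq n h, iteratedDeriv_pow_mul_self hG] at h₁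
  exact mul_left_cancel₀ (Nat.cast_ne_zero.2 n.factorial_ne_zero) h₁

end PartialDerivatives

open Polynomial in
theorem taylor1_polynomial (p : ℂ[X]) : taylor1 (fun z => p.eval z) = (p : PowerSeries ℂ) := by
  ext n
  have h : iteratedDeriv n (fun z => p.eval z) = fun z => (derivative^[n] p).eval z := by
    induction n with
    | zero => simp
    | succ n ih =>
      ext z
      rw [iteratedDeriv_succ, ih, Polynomial.deriv, Function.iterate_succ_apply']
  rw [taylor1, PowerSeries.coeff_mk, h, Polynomial.coeff_coe]
  simp only [← Polynomial.coeff_zero_eq_eval_zero, Polynomial.coeff_iterate_derivative]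
  simp [Nat.descFactorial_self, Nat.factorial_ne_zero]

section ResidueTheorem

open Polynomial HahnSeries

variable {K : Type*} [Field K]

/-- The expansion of a polynomial at `c`, as a Laurent series in `t - c`. -/
noncomputable def expandAtHom (c : K) : K[X] →+* LaurentSeries K :=
  (ofPowerSeries ℤ K).comp
    (coeToPowerSeries.ringHom.comp (taylorEquiv c : K[X] ≃ₐ[K] K[X]).toRingEquiv.toRingHom)

theorem expandAtHom_apply (c : K) (p : K[X]) :
    expandAtHom c p = ofPowerSeries ℤ K (taylor c p : PowerSeries K) := rfl

theorem expandAtHom_injective (c : K) : Function.Injective (expandAtHom c) :=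
  ofPowerSeries_injective.comp ((coe_injective K).comp (taylor_injective c))

/-- The expansion of a polynomial at infinity, as a Laurent series in `s = 1 / t`. -/
noncomputable def expandAtInftyHom : K[X] →+* LaurentSeries K :=
  eval₂RingHom HahnSeries.C (single (-1 : ℤ) (1 : K))

theorem expandAtInftyHom_apply (p : K[X]) :
    expandAtInftyHom p = ∑ n ∈ p.support, single (-(n : ℤ)) (p.coeff n) := by
  simp [expandAtInftyHom, eval₂_eq_sum, Polynomial.sum, single_pow]

theorem coeff_expandAtInftyHom_neg (p : K[X]) (n : ℕ) :
    (expandAtInftyHom p).coeff (-(n : ℤ)) = p.coeff n := by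
  rw [expandAtInftyHom_apply]
  simp [HahnSeries.coeff_sum, HahnSeries.coeff_single, eq_comm]

theorem coeff_expandAtInftyHom_of_pos (p : K[X]) {m : ℤ} (hm : 0 < m) :
    (expandAtInftyHom p).coeff m = 0 := by
  rw [expandAtInftyHom_apply, HahnSeries.coeff_sum]
  exact Finset.sum_eq_zero fun n _ => coeff_single_of_ne (by lia)

theorem expandAtInftyHom_injective : Function.Injective (expandAtInftyHom (K := K)) := by
  intro p q h
  ext n
  rw [← coeff_expandAtInftyHom_neg, h, coeff_expandAtInftyHom_neg]

/-- The Laurent expansion of a rational function at `c`. -/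
noncomputable def expandAt (c : K) : RatFunc K →+* LaurentSeries K :=
  IsFractionRing.lift (expandAtHom_injective c)

/-- The Laurent expansion of a rational function at infinity, in the variable `s = 1 / t`. -/
noncomputable def expandAtInfty : RatFunc K →+* LaurentSeries K :=
  IsFractionRing.lift expandAtInftyHom_injective

theorem expandAt_algebraMap (c : K) (p : K[X]) :
    expandAt c (algebraMap K[X] (RatFunc K) p) = expandAtHom c p :=
  IsFractionRing.lift_algebraMap _ _

theorem expandAtInfty_algebraMap (p : K[X]) :
    expandAtInfty (algebraMap K[X] (RatFunc K) p) = expandAtInftyHom p :=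
  IsFractionRing.lift_algebraMap _ _

theorem expandAt_C (c a : K) : expandAt c (RatFunc.C a) = HahnSeries.C a := by
  rw [← RatFunc.algebraMap_C, expandAt_algebraMap, expandAtHom_apply]
  simp

theorem expandAtInfty_C (a : K) : expandAtInfty (RatFunc.C a) = HahnSeries.C a := by
  rw [← RatFunc.algebraMap_C, expandAtInfty_algebraMap]
  simp [expandAtInftyHom]

theorem expandAt_X (c : K) : expandAt c RatFunc.X = single 1 1 + HahnSeries.C c := by
  rw [← RatFunc.algebraMap_X, expandAt_algebraMap, expandAtHom_apply]
  simp

theorem expandAtInfty_X : expandAtInfty (RatFunc.X (K := K)) = single (-1) 1 := by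
  rw [← RatFunc.algebraMap_X, expandAtInfty_algebraMap]
  simp [expandAtInftyHom]

/-- A power series with nonzero constant coefficient has Laurent series powers without
negative part. -/
theorem ofPowerSeries_zpow {u : PowerSeries K} (hu : PowerSeries.constantCoeff u ≠ 0) (n : ℤ) :
    ∃ w : PowerSeries K, (ofPowerSeries ℤ K u) ^ n = ofPowerSeries ℤ K w ∧
      PowerSeries.constantCoeff w = PowerSeries.constantCoeff u ^ n := by
  have hinv : ofPowerSeries ℤ K u⁻¹ = (ofPowerSeries ℤ K u)⁻¹ := by
    refine eq_inv_of_mul_eq_one_left ?_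
    rw [← map_mul, PowerSeries.inv_mul_cancel _ hu, map_one]
  obtain ⟨m, rfl | rfl⟩ := n.eq_nat_or_neg
  · exact ⟨u ^ m, by simp, by simp⟩
  · exact ⟨u⁻¹ ^ m, by simp [hinv], by simp⟩

theorem coeff_ofPowerSeries_of_neg (w : PowerSeries K) {m : ℤ} (hm : m < 0) :
    (ofPowerSeries ℤ K w).coeff m = 0 := by
  rw [PowerSeries.coeff_coe, if_pos hm]

/-- The residue at `d` of `(t - c) ^ n`. -/
theorem coeff_expandAt_X_sub_C_zpow [DecidableEq K] (c d : K) (n : ℤ) :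
    (expandAt d ((RatFunc.X - RatFunc.C c) ^ n)).coeff (-1) =
      if d = c then (if n = -1 then 1 else 0) else 0 := by
  rw [map_zpow₀, map_sub, expandAt_X, expandAt_C]
  split_ifs with hd hn
  · simp [hd, hn]
  · rw [hd, add_sub_cancel_right, ← RatFunc.single_zpow]
    exact coeff_single_of_ne (Ne.symm hn)
  · have h : (single 1 1 + HahnSeries.C d - HahnSeries.C c : LaurentSeries K) =
        ofPowerSeries ℤ K (PowerSeries.X + PowerSeries.C (d - c)) := by
      simp [add_sub_assoc]
    obtain ⟨w, hw, -⟩ := ofPowerSeries_zpow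
      (u := PowerSeries.X + PowerSeries.C (d - c)) (by simpa [sub_eq_zero] using hd) n
    rw [h, hw, coeff_ofPowerSeries_of_neg _ (by lia)]

/-- The coefficient of `1 / t` in the expansion at infinity of `(t - c) ^ n`. -/
theorem coeff_expandAtInfty_X_sub_C_zpow (c : K) (n : ℤ) :
    (expandAtInfty ((RatFunc.X - RatFunc.C c) ^ n)).coeff 1 = if n = -1 then 1 else 0 := by
  obtain hn | hn := le_or_gt 0 n
  · obtain ⟨m, rfl⟩ := Int.eq_ofNat_of_zero_le hn
    rw [if_neg (by lia), zpow_natCast, ← RatFunc.algebraMap_X, ← RatFunc.algebraMap_C,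
      ← map_sub, ← map_pow, expandAtInfty_algebraMap, coeff_expandAtInftyHom_of_pos _ one_pos]
  · have h : (single (-1) 1 - HahnSeries.C c : LaurentSeries K) =
        single (-1) 1 * ofPowerSeries ℤ K (1 - PowerSeries.C c * PowerSeries.X) := by
      simp [mul_sub, HahnSeries.C_apply]
    obtain ⟨w, hw, hw'⟩ := ofPowerSeries_zpow
      (u := 1 - PowerSeries.C c * PowerSeries.X) (by simp) n
    have hs : (single (-1 : ℤ) (1 : K)) ^ n = single (-n) 1 := by
      have : (single (-1 : ℤ) (1 : K)) = (single (1 : ℤ) (1 : K))⁻¹ := by simp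
      rw [this, inv_zpow', ← RatFunc.single_zpow]
    rw [map_zpow₀, map_sub, expandAtInfty_X, expandAtInfty_C, h, mul_zpow, hs, hw,
      coeff_single_mul, one_mul]
    split_ifs with hn'
    · subst hn'
      simpa [PowerSeries.coeff_coe] using hw'
    · exact coeff_ofPowerSeries_of_neg _ (by lia)

variable (K) in
/-- The space of rational functions satisfying the residue theorem. -/
noncomputable def residueTheoremSubmodule : Submodule K (RatFunc K) where
  carrier := {r | (Function.support fun c => (expandAt c r).coeff (-1)).Finite ∧
    ∑ᶠ c, (expandAt c r).coeff (-1) = (expandAtInfty r).coeff 1}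
  zero_mem' := by simp
  add_mem' := by
    rintro r s ⟨hr, hr'⟩ ⟨hs, hs'⟩
    simp only [Set.mem_ofPred_eq, map_add, HahnSeries.coeff_add]
    exact ⟨(hr.union hs).subset (Function.support_add _ _),
      by rw [finsum_add_distrib hr hs, hr', hs']⟩
  smul_mem' := by
    rintro a r ⟨hr, hr'⟩
    simp only [Set.mem_ofPred_eq, RatFunc.smul_eq_C_mul, map_mul, expandAt_C, expandAtInfty_C,
      HahnSeries.C_mul_eq_smul, HahnSeries.coeff_smul]
    exact ⟨hr.subset (Function.support_const_smul_subset a _), by rw [← smul_finsum, hr']⟩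

variable (K) in
/-- The span of the integral powers of the rational functions `t - c`. -/
noncomputable def zpowSpan : Submodule K (RatFunc K) :=
  Submodule.span K (Set.range fun p : K × ℤ => (RatFunc.X - RatFunc.C p.1) ^ p.2)

theorem zpow_mem_zpowSpan (c : K) (n : ℤ) : (RatFunc.X - RatFunc.C c) ^ n ∈ zpowSpan K :=
  Submodule.subset_span ⟨(c, n), rfl⟩

theorem zpowSpan_le_residueTheoremSubmodule : zpowSpan K ≤ residueTheoremSubmodule K := by
  classical
  refine Submodule.span_le.2 ?_
  rintro _ ⟨⟨c, n⟩, rfl⟩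
  refine ⟨?_, ?_⟩
  · refine (Set.finite_singleton c).subset fun d hd => ?_
    by_contra h
    exact hd ((coeff_expandAt_X_sub_C_zpow c d n).trans (if_neg h))
  · simp only [coeff_expandAt_X_sub_C_zpow, coeff_expandAtInfty_X_sub_C_zpow]
    rw [finsum_eq_single _ c fun d hd => if_neg hd, if_pos rfl]

theorem RatFunc.X_sub_C_ne_zero (c : K) : (RatFunc.X - RatFunc.C c : RatFunc K) ≠ 0 := by
  rw [← RatFunc.algebraMap_X, ← RatFunc.algebraMap_C, ← map_sub]
  exact RatFunc.algebraMap_ne_zero (Polynomial.X_sub_C_ne_zero c)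

theorem zpow_mul_inv_mem_zpowSpan (c d : K) (n : ℤ) :
    (RatFunc.X - RatFunc.C d) ^ n * (RatFunc.X - RatFunc.C c)⁻¹ ∈ zpowSpan K := by
  have hc := RatFunc.X_sub_C_ne_zero c
  have hd := RatFunc.X_sub_C_ne_zero d
  rcases eq_or_ne c d with rfl | hcd
  · rw [← zpow_sub_one₀ hc]
    exact zpow_mem_zpowSpan _ _
  have hcd' : (RatFunc.C (c - d) : RatFunc K) ≠ 0 := by
    rwa [_root_.map_ne_zero, sub_ne_zero]
  induction n with
  | zero => simpa using zpow_mem_zpowSpan c (-1)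
  | succ n ih =>
    have h : (RatFunc.X - RatFunc.C d) ^ ((n : ℤ) + 1) * (RatFunc.X - RatFunc.C c)⁻¹ =
        (RatFunc.X - RatFunc.C d) ^ (n : ℤ) +
          (c - d) • ((RatFunc.X - RatFunc.C d) ^ (n : ℤ) * (RatFunc.X - RatFunc.C c)⁻¹) := by
      rw [zpow_add_one₀ hd, RatFunc.smul_eq_C_mul, map_sub]
      field_simp
      ring
    rw [h]
    exact add_mem (zpow_mem_zpowSpan _ _) (Submodule.smul_mem _ _ ih)
  | pred n ih =>
    have h : (RatFunc.X - RatFunc.C d) ^ (-(n : ℤ) - 1) * (RatFunc.X - RatFunc.C c)⁻¹ =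
        (c - d)⁻¹ • ((RatFunc.X - RatFunc.C d) ^ (-(n : ℤ)) * (RatFunc.X - RatFunc.C c)⁻¹ -
          (RatFunc.X - RatFunc.C d) ^ (-(n : ℤ) - 1)) := by
      rw [zpow_sub_one₀ hd, RatFunc.smul_eq_C_mul, map_inv₀, eq_inv_mul_iff_mul_eq₀ hcd',
        map_sub]
      field_simp
      ring
    rw [h]
    exact Submodule.smul_mem _ _ (sub_mem ih (zpow_mem_zpowSpan _ _))

theorem mul_inv_mem_zpowSpan {r : RatFunc K} (hr : r ∈ zpowSpan K) (c : K) :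
    r * (RatFunc.X - RatFunc.C c)⁻¹ ∈ zpowSpan K := by
  induction hr using Submodule.span_induction with
  | mem x h =>
    obtain ⟨⟨d, n⟩, rfl⟩ := h
    exact zpow_mul_inv_mem_zpowSpan c d n
  | zero => simp
  | add x y _ _ hx hy => rw [add_mul]; exact add_mem hx hy
  | smul a x _ hx => rw [smul_mul_assoc]; exact Submodule.smul_mem _ _ hx

theorem algebraMap_mem_zpowSpan (p : K[X]) : algebraMap K[X] (RatFunc K) p ∈ zpowSpan K := by
  induction p using Polynomial.induction_on' with
  | add p q hp hq => rw [map_add]; exact add_mem hp hq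
  | monomial n a =>
    have h : algebraMap K[X] (RatFunc K) (monomial n a) =
        a • (RatFunc.X - RatFunc.C (0 : K)) ^ (n : ℤ) := by
      rw [← C_mul_X_pow_eq_monomial, RatFunc.smul_eq_C_mul]
      simp
    rw [h]
    exact Submodule.smul_mem _ _ (zpow_mem_zpowSpan _ _)

/-- Partial fractions: over an algebraically closed field, the integral powers of the `t - c`
span the rational functions. -/
theorem mem_zpowSpan [IsAlgClosed K] (r : RatFunc K) : r ∈ zpowSpan K := by
  have hprod (s : Multiset K) (p : K[X]) :
      algebraMap K[X] (RatFunc K) p * ((s.map fun c => RatFunc.X - RatFunc.C c).prod)⁻¹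
        ∈ zpowSpan K := by
    induction s using Multiset.induction_on with
    | empty => simpa using algebraMap_mem_zpowSpan p
    | cons c s ih =>
      rw [Multiset.map_cons, Multiset.prod_cons, mul_comm (RatFunc.X - RatFunc.C c), mul_inv,
        ← mul_assoc]
      exact mul_inv_mem_zpowSpan ih c
  have hden : algebraMap K[X] (RatFunc K) r.denom =
      (r.denom.roots.map fun c => RatFunc.X - RatFunc.C c).prod := by
    conv_lhs => rw [(IsAlgClosed.splits r.denom).eq_prod_roots_of_monic r.monic_denom]
    simp [map_multiset_prod, Function.comp_def]
  rw [← RatFunc.num_div_denom r, div_eq_mul_inv, hden]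
  exact hprod _ _

/-- The residue theorem on the projective line. -/
theorem finsum_residue_eq_coeff_expandAtInfty [IsAlgClosed K] (r : RatFunc K) :
    ∑ᶠ c, (expandAt c r).coeff (-1) = (expandAtInfty r).coeff 1 :=
  (zpowSpan_le_residueTheoremSubmodule (mem_zpowSpan r)).2

end ResidueTheorem

section BlowUp

open Polynomial HahnSeries
open Finset.HasAntidiagonal (antidiagonal)

theorem residueAt_polynomial (c : ℂ) (p q : ℂ[X]) :
    residueAt c (fun z => p.eval z) (fun z => q.eval z) =
      (expandAt c (algebraMap ℂ[X] (RatFunc ℂ) p / algebraMap ℂ[X] (RatFunc ℂ) q)).coeff (-1) := by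
  simp only [residueAt, ← taylor_eval, taylor1_polynomial, map_div₀, expandAt_algebraMap,
    expandAtHom_apply]

/-- The dehomogenization `c(t, 1)` of the binary form of degree `n` with coefficients `c`. -/
noncomputable def dehomogFst (c : ℕ → ℕ → ℂ) (n : ℕ) : ℂ[X] :=
  ∑ p ∈ antidiagonal n, Polynomial.C (c p.1 p.2) * X ^ p.1

/-- The dehomogenization `c(1, t)` of the binary form of degree `n` with coefficients `c`. -/
noncomputable def dehomogSnd (c : ℕ → ℕ → ℂ) (n : ℕ) : ℂ[X] :=
  ∑ p ∈ antidiagonal n, Polynomial.C (c p.1 p.2) * X ^ p.2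

theorem coeff_dehomogSnd (c : ℕ → ℕ → ℂ) (i j : ℕ) :
    (dehomogSnd c (i + j)).coeff j = c i j := by
  rw [dehomogSnd, finsetSum_coeff, Finset.sum_eq_single (i, j)]
  · simp
  · rintro ⟨k, l⟩ hkl hne
    rw [Finset.HasAntidiagonal.mem_antidiagonal] at hkl
    rw [coeff_C_mul, coeff_X_pow, if_neg, mul_zero]
    rintro rfl
    exact hne (Prod.ext (by simpa using hkl) rfl)
  · simp

theorem coeff_dehomogSnd_of_lt (c : ℕ → ℕ → ℂ) {n j : ℕ} (h : n < j) :
    (dehomogSnd c n).coeff j = 0 := by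
  rw [dehomogSnd, finsetSum_coeff]
  refine Finset.sum_eq_zero fun p hp => ?_
  rw [Finset.HasAntidiagonal.mem_antidiagonal] at hp
  rw [coeff_C_mul, coeff_X_pow, if_neg (by lia), mul_zero]

/-- The two dehomogenizations of a binary form are exchanged by `t = 1 / s`. -/
theorem expandAtInftyHom_dehomogSnd (c : ℕ → ℕ → ℂ) (n : ℕ) :
    expandAtInftyHom (dehomogSnd c n) =
      single (-(n : ℤ)) 1 * expandAtHom 0 (dehomogFst c n) := by
  rw [dehomogSnd, dehomogFst, map_sum, map_sum, Finset.mul_sum]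
  refine Finset.sum_congr rfl fun p hp => ?_
  have hp' : (p.1 : ℤ) + p.2 = n := by
    exact_mod_cast Finset.HasAntidiagonal.mem_antidiagonal.1 hp
  have h : -(p.2 : ℤ) = -(n : ℤ) + p.1 := by lia
  simp [expandAtInftyHom, expandAtHom_apply, single_pow, HahnSeries.C_apply, h]

/-- The initial form `x a + y b` of a non-dicritical foliation is nonzero in the chart `x = 1`. -/
theorem dehomogSnd_add_X_mul_ne_zero {a b : ℕ → ℕ → ℂ} {n : ℕ}
    (h : ¬ ∀ i j : ℕ, i + j = n + 1 →
      (if i = 0 then 0 else a (i - 1) j) + (if j = 0 then 0 else b i (j - 1)) = 0) :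
    dehomogSnd a n + X * dehomogSnd b n ≠ 0 := by
  contrapose! h
  intro i j hij
  have hcoeff := congrArg (fun p => p.coeff j) h
  have ha : (dehomogSnd a n).coeff j = if i = 0 then 0 else a (i - 1) j := by
    split_ifs with hi
    · exact coeff_dehomogSnd_of_lt a (by lia)
    · obtain rfl : n = i - 1 + j := by lia
      exact coeff_dehomogSnd a _ _
  have hb : (X * dehomogSnd b n).coeff j = if j = 0 then 0 else b i (j - 1) := by
    rcases j with - | j
    · simp
    · obtain rfl : n = i + j := by lia
      simp [coeff_X_mul, coeff_dehomogSnd]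
  simpa [ha, hb] using hcoeff

/-- The sum of the residues in the two charts of the projective line, for polynomials
`A = A(1, t)`, `A' = A(s, 1)` and `B = B(1, t)`, `B' = B(s, 1)` coming from binary forms. -/
theorem finsum_residue_add_residue_eq_neg_one {K : Type*} [Field K] [IsAlgClosed K]
    {A B A' B' : K[X]} {n : ℕ}
    (hA : expandAtInftyHom A = single (-(n : ℤ)) 1 * expandAtHom 0 A')
    (hB : expandAtInftyHom B = single (-(n : ℤ)) 1 * expandAtHom 0 B')
    (hne : A + X * B ≠ 0) :
    ∑ᶠ c, (expandAt c (algebraMap K[X] (RatFunc K) (-B) /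
        algebraMap K[X] (RatFunc K) (A + X * B))).coeff (-1) +
      (expandAt 0 (algebraMap K[X] (RatFunc K) (-A') /
        algebraMap K[X] (RatFunc K) (X * A' + B'))).coeff (-1) = -1 := by
  rw [finsum_residue_eq_coeff_expandAtInfty]
  simp only [map_div₀, expandAt_algebraMap, expandAtInfty_algebraMap]
  have hne' : expandAtInftyHom (A + X * B) ≠ 0 :=
    (map_ne_zero_iff _ expandAtInftyHom_injective).2 hne
  have hXinf : expandAtInftyHom (X : K[X]) = (single (1 : ℤ) (1 : K))⁻¹ := by
    simp [expandAtInftyHom]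
  have hX : expandAtHom 0 (X : K[X]) = single (1 : ℤ) (1 : K) := by
    simp [expandAtHom_apply]
  simp only [map_neg, map_add, map_mul, hA, hB, hX, hXinf] at hne' ⊢
  set α : LaurentSeries K := expandAtHom 0 A'
  set β : LaurentSeries K := expandAtHom 0 B'
  set T : LaurentSeries K := single (1 : ℤ) (1 : K) with hT
  set S : LaurentSeries K := single (-(n : ℤ)) (1 : K) with hS
  have hT0 : T ≠ 0 := by simp [hT]
  have hS0 : S ≠ 0 := by simp [hS]
  have hden : T * α + β ≠ 0 := by
    intro h
    apply hne'
    have : S * α + T⁻¹ * (S * β) = S * T⁻¹ * (T * α + β) := by field_simp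
    rw [this, h, mul_zero]
  have hquot : -(S * β) / (S * α + T⁻¹ * (S * β)) = T * (-1 - T * (-α / (T * α + β))) := by
    have : S * α + T⁻¹ * (S * β) = S * T⁻¹ * (T * α + β) := by field_simp
    rw [this]
    field_simp
    ring
  rw [hquot, hT, coeff_single_mul, one_mul, HahnSeries.coeff_sub, coeff_single_mul, one_mul]
  simp [HahnSeries.coeff_one]

end BlowUp

/-- **Camacho–Sad index theorem for the first blow-up.** Let `𝓕` be given by
`ω = a dx + b dy` on a neighbourhood `U` of `0 ∈ ℂ²`, of multiplicity `ν`, non-dicritical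
(the initial form `x·aᵥ + y·bᵥ` does not vanish identically, so the exceptional divisor `E`
of the blow-up `π` of the origin is invariant under `π⋆𝓕`). Write the strict transform
`π⋆𝓕` in the chart `(x,t) ↦ (x,xt)` as `P dx + x·Q dt` (`x^ν P = a(x,xt) + t·b(x,xt)`,
`x^ν Q = b(x,xt)`), and in the chart `(s,y) ↦ (sy,y)` as `y·C dsy + D dy`
(`y^ν C = a(sy,y)`, `y^ν D = s·a(sy,y) + b(sy,y)`). Then the sum over the singular points
`p` of `π⋆𝓕` on `E` of the Camacho–Sad indices `I_p(π⋆𝓕, E)` — the residues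
`Res_{t=c}(−Q(0,t)/P(0,t))` over `c ∈ ℂ` plus the index `Res_{s=0}(−C(s,0)/D(s,0))` at the
point at infinity of `E` — equals `−1`. -/
theorem camacho_sad_index_theorem_blowup
    (U : Set (ℂ × ℂ)) (hU : U ∈ 𝓝 (0 : ℂ × ℂ))
    (a b : ℂ × ℂ → ℂ) (ha : AnalyticOnNhd ℂ a U) (hb : AnalyticOnNhd ℂ b U)
    (ν : ℕ)
    (hν : ∀ i j : ℕ, i + j < ν → taylorCoeff a i j = 0 ∧ taylorCoeff b i j = 0)
    (hνmin : ∃ i j : ℕ, i + j = ν ∧ (taylorCoeff a i j ≠ 0 ∨ taylorCoeff b i j ≠ 0))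
    (hnondic : ¬ ∀ i j : ℕ, i + j = ν + 1 →
      (if i = 0 then 0 else taylorCoeff a (i - 1) j) +
      (if j = 0 then 0 else taylorCoeff b i (j - 1)) = 0)
    (P Q : ℂ × ℂ → ℂ)
    (hP : AnalyticOnNhd ℂ P {q : ℂ × ℂ | (q.1, q.1 * q.2) ∈ U})
    (hQ : AnalyticOnNhd ℂ Q {q : ℂ × ℂ | (q.1, q.1 * q.2) ∈ U})
    (hPe : ∀ q : ℂ × ℂ, (q.1, q.1 * q.2) ∈ U →
      q.1 ^ ν * P q = a (q.1, q.1 * q.2) + q.2 * b (q.1, q.1 * q.2))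
    (hQe : ∀ q : ℂ × ℂ, (q.1, q.1 * q.2) ∈ U →
      q.1 ^ ν * Q q = b (q.1, q.1 * q.2))
    (C D : ℂ × ℂ → ℂ)
    (hC : AnalyticOnNhd ℂ C {q : ℂ × ℂ | (q.1 * q.2, q.2) ∈ U})
    (hD : AnalyticOnNhd ℂ D {q : ℂ × ℂ | (q.1 * q.2, q.2) ∈ U})
    (hCe : ∀ q : ℂ × ℂ, (q.1 * q.2, q.2) ∈ U →
      q.2 ^ ν * C q = a (q.1 * q.2, q.2))
    (hDe : ∀ q : ℂ × ℂ, (q.1 * q.2, q.2) ∈ U →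
      q.2 ^ ν * D q = q.1 * a (q.1 * q.2, q.2) + b (q.1 * q.2, q.2)) :
    (∑ᶠ c : ℂ, residueAt c (fun t => -(Q (0, t))) (fun t => P (0, t))) +
      residueAt 0 (fun s => -(C (s, 0))) (fun s => D (s, 0)) = -1 := by
  have h0 : (0 : ℂ × ℂ) ∈ U := mem_of_mem_nhds hU
  have ha0 := ha 0 h0
  have hb0 := hb 0 h0
  have hfst (t : ℂ) : ((0 : ℂ), t) ∈ {q : ℂ × ℂ | (q.1, q.1 * q.2) ∈ U} := by
    simpa [Prod.mk_zero_zero] using h0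
  have hsnd (s : ℂ) : (s, (0 : ℂ)) ∈ {q : ℂ × ℂ | (q.1 * q.2, q.2) ∈ U} := by
    simpa [Prod.mk_zero_zero] using h0
  have hUfst (t : ℂ) : ∀ᶠ x in 𝓝 (0 : ℂ), (x, x * t) ∈ U := by
    have h : ContinuousAt (fun x : ℂ => (x, x * t)) 0 := by fun_prop
    exact h.eventually_mem (by simpa [Prod.mk_zero_zero] using hU)
  have hUsnd (s : ℂ) : ∀ᶠ y in 𝓝 (0 : ℂ), (s * y, y) ∈ U := by
    have h : ContinuousAt (fun y : ℂ => (s * y, y)) 0 := by fun_prop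
    exact h.eventually_mem (by simpa [Prod.mk_zero_zero] using hU)
  have hPt (t : ℂ) : AnalyticAt ℂ (fun x => P (x, t)) 0 :=
    AnalyticAt.comp (g := P) (hP _ (hfst t)) (by fun_prop)
  have hQt (t : ℂ) : AnalyticAt ℂ (fun x => Q (x, t)) 0 :=
    AnalyticAt.comp (g := Q) (hQ _ (hfst t)) (by fun_prop)
  have hCs (s : ℂ) : AnalyticAt ℂ (fun y => C (s, y)) 0 :=
    AnalyticAt.comp (g := C) (hC _ (hsnd s)) (by fun_prop)
  have hDs (s : ℂ) : AnalyticAt ℂ (fun y => D (s, y)) 0 :=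
    AnalyticAt.comp (g := D) (hD _ (hsnd s)) (by fun_prop)
  have hQ0 (t : ℂ) : Q (0, t) = (dehomogSnd (taylorCoeff b) ν).eval t := by
    have h := eval_zero_eq_sum_taylorCoeff hb0 (u := 1) (v := t) (hQt t) (n := ν) (by
      filter_upwards [hUfst t] with x hx
      simpa using hQe (x, t) hx)
    simpa [dehomogSnd, Polynomial.eval_finsetSum] using h
  have hP0 (t : ℂ) : P (0, t) =
      (dehomogSnd (taylorCoeff a) ν + Polynomial.X * dehomogSnd (taylorCoeff b) ν).eval t := by
    have hG : AnalyticAt ℂ (fun x => P (x, t) - t * Q (x, t)) 0 :=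
      (hPt t).sub (analyticAt_const.mul (hQt t))
    have h := eval_zero_eq_sum_taylorCoeff ha0 (u := 1) (v := t) (n := ν) hG (by
        filter_upwards [hUfst t] with x hx
        have hPx := hPe (x, t) hx
        have hQx := hQe (x, t) hx
        simp only [mul_one] at hPx hQx ⊢
        linear_combination hPx - t * hQx)
    have h' : P (0, t) - t * Q (0, t) = (dehomogSnd (taylorCoeff a) ν).eval t := by
      simpa [dehomogSnd, Polynomial.eval_finsetSum] using h
    rw [Polynomial.eval_add, Polynomial.eval_mul, Polynomial.eval_X, ← h', ← hQ0]
    ring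
  have hC0 (s : ℂ) : C (s, 0) = (dehomogFst (taylorCoeff a) ν).eval s := by
    have h := eval_zero_eq_sum_taylorCoeff ha0 (u := s) (v := 1) (hCs s) (n := ν) (by
      filter_upwards [hUsnd s] with y hy
      simpa [mul_comm] using hCe (s, y) hy)
    simpa [dehomogFst, Polynomial.eval_finsetSum] using h
  have hD0 (s : ℂ) : D (s, 0) =
      (Polynomial.X * dehomogFst (taylorCoeff a) ν + dehomogFst (taylorCoeff b) ν).eval s := by
    have hG : AnalyticAt ℂ (fun y => D (s, y) - s * C (s, y)) 0 :=
      (hDs s).sub (analyticAt_const.mul (hCs s))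
    have h := eval_zero_eq_sum_taylorCoeff hb0 (u := s) (v := 1) (n := ν) hG (by
        filter_upwards [hUsnd s] with y hy
        have hDy := hDe (s, y) hy
        have hCy := hCe (s, y) hy
        simp only [mul_one, mul_comm y s] at hDy hCy ⊢
        linear_combination hDy - s * hCy)
    have h' : D (s, 0) - s * C (s, 0) = (dehomogFst (taylorCoeff b) ν).eval s := by
      simpa [dehomogFst, Polynomial.eval_finsetSum] using h
    rw [Polynomial.eval_add, Polynomial.eval_mul, Polynomial.eval_X, ← h', ← hC0]
    ring
  simp only [hP0, hQ0, hC0, hD0, ← Polynomial.eval_neg, residueAt_polynomial]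
  exact finsum_residue_add_residue_eq_neg_one (expandAtInftyHom_dehomogSnd _ ν)
    (expandAtInftyHom_dehomogSnd _ ν) (dehomogSnd_add_X_mul_ne_zero hnondic)
end

section
/- Let 𝓖 be a non-dicritical foliation on a surface with exceptional divisor E ≅ ℙ¹ invariant, E of self-intersection −1, and suppose every singularity of 𝓖 on E is simple. Then at least one singular point p of 𝓖 on E carries a separatrix of 𝓖 transverse to E. (Since the indices sum to −1 and simple singularities have non-positive-rational index, not every singularity can have its only separatrices contained in E.) -/
open Filter Topology

/-- `z` is not a positive rational number. -/
def NotPosRat (z : ℂ) : Prop := ∀ q : ℚ, 0 < q → z ≠ (q : ℂ)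

/-- The foliation `A dx + B dy` has (at worst) a simple singularity at `q`: if `q` is a
singular point then the linear part of the dual vector field `(−B, A)` has eigenvalues
`λ₁, λ₂` with `λ₂ ≠ 0` and `λ₁/λ₂` not a positive rational. -/
def SimpleSingPair (A B : ℂ × ℂ → ℂ) (q : ℂ × ℂ) : Prop :=
  A q = 0 → B q = 0 →
    ∃ l₁ l₂ : ℂ,
      l₁ + l₂ = fderiv ℂ (fun z => -B z) q (1, 0) + fderiv ℂ A q (0, 1) ∧
      l₁ * l₂ = fderiv ℂ (fun z => -B z) q (1, 0) * fderiv ℂ A q (0, 1) -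
        fderiv ℂ (fun z => -B z) q (0, 1) * fderiv ℂ A q (1, 0) ∧
      l₂ ≠ 0 ∧ NotPosRat (l₁ / l₂)

/-- A holomorphic `W` on a disc with `W 0 = 0` and `‖z W'(z)‖ ≤ M ‖z‖ ^ N` satisfies
`‖W z‖ ≤ M / N * ‖z‖ ^ N`. -/
lemma norm_le_of_norm_mul_deriv_le {W : ℂ → ℂ} {ρ M : ℝ} {N : ℕ} (hN : 1 ≤ N)
    (hW : DifferentiableOn ℂ W (Metric.ball 0 ρ)) (hW0 : W 0 = 0)
    (h : ∀ z ∈ Metric.ball (0 : ℂ) ρ, ‖z * deriv W z‖ ≤ M * ‖z‖ ^ N)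
    {z : ℂ} (hz : z ∈ Metric.ball (0 : ℂ) ρ) : ‖W z‖ ≤ M / N * ‖z‖ ^ N := by
  have hmem : ∀ t ∈ Set.Icc (0 : ℝ) 1, (t : ℂ) * z ∈ Metric.ball (0 : ℂ) ρ := by
    intro t ht
    rw [mem_ball_zero_iff] at hz ⊢
    rw [norm_mul, Complex.norm_real, Real.norm_of_nonneg ht.1]
    exact (mul_le_of_le_one_left (norm_nonneg _) ht.2).trans_lt hz
  have hder : ∀ t ∈ Set.Icc (0 : ℝ) 1,
      HasDerivAt (fun s : ℝ => W ((s : ℂ) * z)) (z * deriv W (t * z)) t := by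
    intro t ht
    have h1 : HasDerivAt W (deriv W (t * z)) ((t : ℂ) * z) :=
      (hW.differentiableAt (Metric.isOpen_ball.mem_nhds (hmem t ht))).hasDerivAt
    have h2 : HasDerivAt (fun s : ℝ => (s : ℂ) * z) (1 * z) t :=
      (Complex.ofRealCLM.hasDerivAt (x := t)).mul_const z
    exact (HasDerivAt.comp (h₂ := W) t h1 h2).congr_deriv (by ring)
  have hB : ∀ t : ℝ, HasDerivAt (fun s : ℝ => M / N * ‖z‖ ^ N * s ^ N)
      (M * ‖z‖ ^ N * t ^ (N - 1)) t := by
    intro t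
    have hN0 : (N : ℝ) ≠ 0 := by positivity
    exact ((hasDerivAt_pow N t).const_mul (M / N * ‖z‖ ^ N)).congr_deriv (by field_simp)
  have hbound : ∀ t ∈ Set.Icc (0 : ℝ) 1, 0 < t →
      ‖z * deriv W (t * z)‖ ≤ M * ‖z‖ ^ N * t ^ (N - 1) := by
    intro t ht ht0
    have h1 := h _ (hmem t ht)
    obtain ⟨k, rfl⟩ : ∃ k, N = k + 1 := ⟨N - 1, by omega⟩
    simp only [norm_mul, Complex.norm_real, Real.norm_of_nonneg ht.1] at h1 ⊢
    refine le_of_mul_le_mul_left ?_ ht0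
    calc t * (‖z‖ * ‖deriv W (t * z)‖) = t * ‖z‖ * ‖deriv W (t * z)‖ := by ring
      _ ≤ _ := h1
      _ = _ := by simp only [Nat.add_sub_cancel]; ring
  have hbound0 : ‖z * deriv W ((0 : ℝ) * z)‖ ≤ M * ‖z‖ ^ N * 0 ^ (N - 1) := by
    have hc1 : ContinuousWithinAt (fun t : ℝ => ‖z * deriv W (t * z)‖) (Set.Ioc 0 1) 0 := by
      have hd : ContinuousAt (deriv W) (((0 : ℝ) : ℂ) * z) :=
        ((hW.deriv Metric.isOpen_ball).differentiableAt (Metric.isOpen_ball.mem_nhds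
          (hmem 0 (by simp)))).continuousAt
      have hm : ContinuousAt (fun t : ℝ => (t : ℂ) * z) 0 := by fun_prop
      exact (continuousAt_const.mul (ContinuousAt.comp (g := deriv W)
        (f := fun t : ℝ => (t : ℂ) * z) hd hm)).norm.continuousWithinAt
    have hc2 : ContinuousWithinAt (fun t : ℝ => M * ‖z‖ ^ N * t ^ (N - 1)) (Set.Ioc 0 1) 0 := by
      fun_prop
    have : (𝓝[Set.Ioc (0 : ℝ) 1] 0).NeBot := by
      rw [nhdsWithin_Ioc_eq_nhdsGT one_pos]; infer_instance
    exact le_of_tendsto_of_tendsto hc1 hc2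
      (eventually_nhdsWithin_of_forall fun t ht => hbound t ⟨ht.1.le, ht.2⟩ ht.1)
  have key := image_norm_le_of_norm_deriv_right_le_deriv_boundary
    (f := fun s : ℝ => W ((s : ℂ) * z)) (a := 0) (b := 1)
    (fun t ht => (hder t ht).continuousAt.continuousWithinAt)
    (fun t ht => (hder t ⟨ht.1, ht.2.le⟩).hasDerivWithinAt)
    (by simp [hW0, zero_pow (by omega : N ≠ 0)]) hB
    (fun t ht => by
      rcases ht.1.eq_or_lt with rfl | h0
      · exact hbound0
      · exact hbound t ⟨ht.1, ht.2.le⟩ h0) (x := 1) (by simp)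
  simpa using key

lemma exists_mul_deriv_eq {g : ℂ → ℂ} {ρ : ℝ} (hρ : 0 < ρ)
    (hg : DifferentiableOn ℂ g (Metric.ball 0 ρ)) (hg0 : g 0 = 0) :
    ∃ W : ℂ → ℂ, DifferentiableOn ℂ W (Metric.ball 0 ρ) ∧ W 0 = 0 ∧
      ∀ z ∈ Metric.ball (0 : ℂ) ρ, z * deriv W z = g z := by
  have hd : DifferentiableOn ℂ (dslope g 0) (Metric.ball 0 ρ) :=
    (Complex.differentiableOn_dslope (Metric.ball_mem_nhds 0 hρ)).2 hg
  obtain ⟨W, hW0, hW⟩ := hd.isExactOn_ball.with_val_at 0 0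
  refine ⟨W, fun z hz => (hW z hz).differentiableAt.differentiableWithinAt, hW0, fun z hz => ?_⟩
  rw [(hW z hz).deriv]
  simpa [hg0] using sub_smul_dslope g 0 z

/-- Picard iteration for `x φ' = F (x, φ)` starting at an approximate solution `T` of high
order. -/
lemma exists_solution_of_approx {F : ℂ × ℂ → ℂ} {r : ℝ} {K : NNReal}
    (hF : ∀ z ∈ Metric.ball (0 : ℂ × ℂ) r, DifferentiableAt ℂ F z)
    (hK : LipschitzOnWith K F (Metric.ball 0 r)) (hF0 : F 0 = 0)
    {N : ℕ} (hN : 1 ≤ N) (hKN : 2 * (K : ℝ) ≤ N) {T : ℂ → ℂ} {ρ M : ℝ} (hρ : 0 < ρ) (hρr : ρ ≤ r)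
    (hM : 0 ≤ M) (hT : DifferentiableOn ℂ T (Metric.ball 0 ρ)) (hT0 : T 0 = 0)
    (hR : ∀ x ∈ Metric.ball (0 : ℂ) ρ, ‖F (x, T x) - x * deriv T x‖ ≤ M * ‖x‖ ^ N)
    (hsmall : ∀ x ∈ Metric.ball (0 : ℂ) ρ, ‖T x‖ + 2 * M * ‖x‖ ^ N < r) :
    ∃ φ : ℂ → ℂ, DifferentiableOn ℂ φ (Metric.ball 0 ρ) ∧ φ 0 = 0 ∧
      ∀ x ∈ Metric.ball (0 : ℂ) ρ, x * deriv φ x = F (x, φ x) := by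
  have hNR : (1 : ℝ) ≤ N := by exact_mod_cast hN
  let Good : (ℂ → ℂ) → Prop := fun φ => DifferentiableOn ℂ φ (Metric.ball 0 ρ) ∧ φ 0 = 0 ∧
    ∀ x ∈ Metric.ball (0 : ℂ) ρ, ‖φ x - T x‖ ≤ 2 * M * ‖x‖ ^ N
  have hbox : ∀ φ, Good φ → ∀ x ∈ Metric.ball (0 : ℂ) ρ, (x, φ x) ∈ Metric.ball (0 : ℂ × ℂ) r := by
    intro φ hφ x hx
    rw [mem_ball_zero_iff, Prod.norm_mk, max_lt_iff]
    refine ⟨(mem_ball_zero_iff.1 hx).trans_le hρr, ?_⟩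
    have h1 := hφ.2.2 x hx
    have h2 := hsmall x hx
    have h3 : ‖φ x‖ ≤ ‖T x‖ + ‖φ x - T x‖ := norm_le_norm_add_norm_sub' _ _
    linarith
  have hTgood : Good T := ⟨hT, hT0, fun x _ => by simp; positivity⟩
  have hLip : ∀ φ χ, Good φ → Good χ → ∀ x ∈ Metric.ball (0 : ℂ) ρ,
      ‖F (x, φ x) - F (x, χ x)‖ ≤ K * ‖φ x - χ x‖ := by
    intro φ χ hφ hχ x hx
    have := hK.norm_sub_le (hbox φ hφ x hx) (hbox χ hχ x hx)
    simpa [Prod.norm_mk] using this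
  have hd : ∀ φ : ℂ → ℂ, DifferentiableOn ℂ φ (Metric.ball 0 ρ) → ∀ x ∈ Metric.ball (0 : ℂ) ρ,
      DifferentiableAt ℂ φ x := fun φ hφ x hx =>
    DifferentiableOn.differentiableAt hφ (Metric.isOpen_ball.mem_nhds hx)
  have hstep : ∀ φ, Good φ → ∃ W, Good W ∧
      ∀ x ∈ Metric.ball (0 : ℂ) ρ, x * deriv W x = F (x, φ x) := by
    intro φ hφ
    obtain ⟨W, hWd, hW0, hW⟩ := exists_mul_deriv_eq (g := fun x => F (x, φ x)) hρ
      (fun x hx => (DifferentiableAt.comp (g := F) (f := fun x => (x, φ x)) x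
        (hF _ (hbox φ hφ x hx))
        (differentiableAt_id.prodMk (hd φ hφ.1 x hx))).differentiableWithinAt)
      (by simp only [hφ.2.1]; exact hF0)
    refine ⟨W, ⟨hWd, hW0, fun x hx => ?_⟩, hW⟩
    have := norm_le_of_norm_mul_deriv_le (W := fun x => W x - T x) (M := (2 * K + 1) * M) hN
      (hWd.sub hT) (by simp [hW0, hT0]) (fun z hz => ?_) hx
    · refine this.trans ?_
      gcongr
      rw [div_le_iff₀ (by positivity)]
      nlinarith
    · have e : z * deriv (fun x => W x - T x) z
          = (F (z, φ z) - F (z, T z)) + (F (z, T z) - z * deriv T z) := by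
        rw [deriv_fun_sub (hd W hWd z hz) (hd T hT z hz), mul_sub, hW z hz]; ring
      rw [e]
      refine (norm_add_le _ _).trans ?_
      have h1 := hLip φ T hφ hTgood z hz
      have h2 := hR z hz
      have h3 := mul_le_mul_of_nonneg_left (hφ.2.2 z hz) K.coe_nonneg
      linarith
  choose! S hSgood hS using hstep
  let u : ℕ → ℂ → ℂ := fun n => S^[n] T
  have hu_succ : ∀ n, u (n + 1) = S (u n) := fun n => Function.iterate_succ_apply' S n T
  have hu : ∀ n, Good (u n) := by
    intro n
    induction n with
    | zero => exact hTgood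
    | succ n ih => rw [hu_succ]; exact hSgood _ ih
  have hcontr : ∀ n, ∀ x ∈ Metric.ball (0 : ℂ) ρ,
      ‖u n x - u (n + 1) x‖ ≤ 2 * M * (1 / 2) ^ n * ‖x‖ ^ N := by
    intro n
    induction n with
    | zero =>
      intro x hx
      rw [norm_sub_rev]
      simpa [u] using (hu 1).2.2 x hx
    | succ n ih =>
      intro x hx
      have := norm_le_of_norm_mul_deriv_le (W := fun x => u (n + 1) x - u (n + 2) x)
        (M := K * (2 * M * (1 / 2) ^ n)) hN
        ((hu _).1.sub (hu _).1) (by simp [(hu _).2.1]) (fun z hz => ?_) hx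
      · refine this.trans ?_
        gcongr
        rw [div_le_iff₀ (by positivity)]
        have h0 : 0 ≤ M * (1 / 2 : ℝ) ^ n := by positivity
        rw [pow_succ]
        nlinarith
      · rw [deriv_fun_sub (hd _ (hu _).1 z hz) (hd _ (hu _).1 z hz), mul_sub, hu_succ (n + 1),
          hS _ (hu _) z hz, hu_succ n, hS _ (hu _) z hz, ← hu_succ n]
        refine (hLip _ _ (hu _) (hu _) z hz).trans ?_
        rw [mul_assoc]
        gcongr
        exact ih z hz
  have hcontr' : ∀ x ∈ Metric.ball (0 : ℂ) ρ, ∀ n,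
      dist (u n x) (u (n + 1) x) ≤ 2 * M * ρ ^ N * (1 / 2) ^ n := by
    intro x hx n
    rw [dist_eq_norm]
    refine (hcontr n x hx).trans ?_
    have : ‖x‖ ^ N ≤ ρ ^ N := by
      gcongr; exact (mem_ball_zero_iff.1 hx).le
    have h0 : 0 ≤ M * (1 / 2 : ℝ) ^ n := by positivity
    nlinarith
  have hlim : ∀ x ∈ Metric.ball (0 : ℂ) ρ, ∃ y, Tendsto (fun n => u n x) atTop (𝓝 y) :=
    fun x hx => cauchySeq_tendsto_of_complete
      (cauchySeq_of_le_geometric _ _ (by norm_num) (hcontr' x hx))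
  choose! φ hφ using hlim
  have hunif : TendstoUniformlyOn u φ atTop (Metric.ball 0 ρ) := by
    rw [Metric.tendstoUniformlyOn_iff]
    intro ε hε
    have ht : Tendsto (fun n : ℕ => 2 * M * ρ ^ N * (1 / 2 : ℝ) ^ n / (1 - 1 / 2)) atTop (𝓝 0) := by
      have := ((tendsto_pow_atTop_nhds_zero_of_lt_one (r := (1 / 2 : ℝ)) (by norm_num)
        (by norm_num)).const_mul (2 * M * ρ ^ N)).div_const (1 - 1 / 2)
      simpa using this
    filter_upwards [ht.eventually_lt_const hε] with n hn x hx
    rw [dist_comm]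
    exact (dist_le_of_le_geometric_of_tendsto _ _ (by norm_num) (hcontr' x hx) (hφ x hx) n).trans_lt
      hn
  have hloc := hunif.tendstoLocallyUniformlyOn
  have hdu : ∀ᶠ n in atTop, DifferentiableOn ℂ (u n) (Metric.ball 0 ρ) :=
    Eventually.of_forall fun n => (hu n).1
  have h0mem : (0 : ℂ) ∈ Metric.ball (0 : ℂ) ρ := Metric.mem_ball_self hρ
  have hφd := hloc.differentiableOn hdu Metric.isOpen_ball
  have hφ0 : φ 0 = 0 := tendsto_nhds_unique (hφ 0 h0mem) (by simp [(hu _).2.1])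
  have hφgood : Good φ := by
    refine ⟨hφd, hφ0, fun x hx => ?_⟩
    exact le_of_tendsto ((hφ x hx).sub_const (T x)).norm
      (Eventually.of_forall fun n => (hu n).2.2 x hx)
  refine ⟨φ, hφd, hφ0, fun x hx => ?_⟩
  have hder : Tendsto (fun n => x * deriv (u (n + 1)) x) atTop (𝓝 (x * deriv φ x)) :=
    (((hloc.deriv hdu Metric.isOpen_ball).tendsto_at hx).comp (tendsto_add_atTop_nat 1)).const_mul x
  refine tendsto_nhds_unique hder ?_
  have hFc : Tendsto (fun n => F (x, u n x)) atTop (𝓝 (F (x, φ x))) :=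
    ((hF _ (hbox φ hφgood x hx)).continuousAt.tendsto).comp
      ((tendsto_const_nhds (x := x)).prodMk_nhds (hφ x hx))
  exact hFc.congr fun n => by rw [hu_succ, hS _ (hu n) x hx]

/-- An analytic germ that is `o(x ^ n)` is divisible by `x ^ (n + 1)`. -/
lemma AnalyticAt.exists_eq_pow_succ_mul_of_isLittleO {f : ℂ → ℂ} (hf : AnalyticAt ℂ f 0) {n : ℕ}
    (h : f =o[𝓝 0] fun x => x ^ n) :
    ∃ g : ℂ → ℂ, AnalyticAt ℂ g 0 ∧ ∀ᶠ x in 𝓝 0, f x = x ^ (n + 1) * g x := by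
  have hle : ((n + 1 : ℕ) : ℕ∞) ≤ analyticOrderAt f 0 := by
    by_contra! hlt
    obtain ⟨m, hm⟩ := ENat.ne_top_iff_exists.1 hlt.ne_top
    rw [← hm, Nat.cast_lt] at hlt
    obtain ⟨g, hg, hg0, hfg⟩ := hf.analyticOrderAt_eq_natCast.1 hm.symm
    have hpow : (fun x : ℂ => x ^ n) =O[𝓝 0] fun x : ℂ => x ^ m := by
      refine Asymptotics.IsBigO.of_bound 1 ?_
      filter_upwards [Metric.ball_mem_nhds (0 : ℂ) one_pos] with x hx
      rw [one_mul, norm_pow, norm_pow]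
      exact pow_le_pow_of_le_one (norm_nonneg _) (mem_ball_zero_iff.1 hx).le (by omega)
    have ht := ((h.trans_isBigO hpow).mono nhdsWithin_le_nhds :
      f =o[𝓝[≠] 0] fun x => x ^ m).tendsto_div_nhds_zero
    refine hg0 (tendsto_nhds_unique
      (hg.continuousAt.tendsto.mono_left (nhdsWithin_le_nhds (s := {0}ᶜ))) (ht.congr' ?_))
    filter_upwards [nhdsWithin_le_nhds hfg, self_mem_nhdsWithin] with x hx hx0
    rw [hx, sub_zero, smul_eq_mul]
    exact mul_div_cancel_left₀ _ (pow_ne_zero _ hx0)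
  obtain ⟨g, hg, hfg⟩ := (natCast_le_analyticOrderAt hf).1 hle
  exact ⟨g, hg, by simpa using hfg⟩

/-- Approximate solutions of arbitrary order of the Briot–Bouquet equation
`x φ' = F (x, φ)`. -/
lemma exists_approx_solution {F : ℂ × ℂ → ℂ} (hF : AnalyticAt ℂ F 0) (hF0 : F 0 = 0)
    (hl : ∀ n : ℕ, 1 ≤ n → fderiv ℂ F 0 (0, 1) ≠ n) (n : ℕ) :
    ∃ T : ℂ → ℂ, AnalyticAt ℂ T 0 ∧ T 0 = 0 ∧ ∃ g : ℂ → ℂ, AnalyticAt ℂ g 0 ∧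
      ∀ᶠ x in 𝓝 0, F (x, T x) - x * deriv T x = x ^ (n + 1) * g x := by
  have han : ∀ T : ℂ → ℂ, AnalyticAt ℂ T 0 → T 0 = 0 →
      AnalyticAt ℂ (fun x => F (x, T x) - x * deriv T x) 0 := by
    intro T hT hT0
    have h1 : AnalyticAt ℂ (fun x => F (x, T x)) 0 := by
      refine AnalyticAt.comp₂ (f := fun x => x) (g := T) ?_ analyticAt_id hT
      rw [hT0]; exact hF
    exact h1.sub (analyticAt_id.mul hT.deriv)
  induction n with
  | zero =>
    refine ⟨fun _ => 0, analyticAt_const, rfl, ?_⟩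
    refine (han _ analyticAt_const rfl).exists_eq_pow_succ_mul_of_isLittleO ?_
    simp only [pow_zero, deriv_const', mul_zero, sub_zero]
    rw [Asymptotics.isLittleO_one_iff]
    have : ContinuousAt (fun x : ℂ => F (x, 0)) 0 :=
      ContinuousAt.comp (g := F) (f := fun x : ℂ => (x, (0 : ℂ))) hF.continuousAt (by fun_prop)
    have h2 := this.tendsto
    rwa [show F (0, 0) = 0 from hF0] at h2
  | succ n ih =>
    obtain ⟨T, hT, hT0, g, hg, hTg⟩ := ih
    set l := fderiv ℂ F 0 (0, 1) with hldef
    have hne : ((n + 1 : ℕ) : ℂ) - l ≠ 0 := sub_ne_zero.2 (hl (n + 1) (by omega)).symm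
    set e := g 0 / (((n + 1 : ℕ) : ℂ) - l) with he
    have hTe : AnalyticAt ℂ (fun x : ℂ => T x + e * x ^ (n + 1)) 0 := by fun_prop
    refine ⟨fun x => T x + e * x ^ (n + 1), hTe, by simp [hT0], ?_⟩
    refine (han _ hTe (by simp [hT0])).exists_eq_pow_succ_mul_of_isLittleO ?_
    have hstrict : HasStrictFDerivAt F (fderiv ℂ F 0) 0 := hF.hasStrictFDerivAt
    have hcurve : Tendsto (fun x : ℂ => ((x, T x + e * x ^ (n + 1)), (x, T x))) (𝓝 0)
        (𝓝 ((0 : ℂ × ℂ), (0 : ℂ × ℂ))) := by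
      have hc : ContinuousAt (fun x : ℂ => ((x, T x + e * x ^ (n + 1)), (x, T x))) 0 :=
        (continuousAt_id.prodMk hTe.continuousAt).prodMk
          (continuousAt_id.prodMk hT.continuousAt)
      have h := hc.tendsto
      simp only [hT0, ne_eq, Nat.add_eq_zero_iff, one_ne_zero, and_false, not_false_eq_true,
        zero_pow, mul_zero, add_zero] at h
      exact h
    have h1 : (fun x : ℂ => F (x, T x + e * x ^ (n + 1)) - F (x, T x) - l * (e * x ^ (n + 1)))
        =o[𝓝 0] fun x => x ^ (n + 1) := by
      have h := (hstrict.isLittleO.comp_tendsto hcurve)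
      have hO : (fun x : ℂ => ((x, T x + e * x ^ (n + 1)) - (x, T x) : ℂ × ℂ))
          =O[𝓝 0] fun x => x ^ (n + 1) := by
        refine Asymptotics.IsBigO.of_bound ‖e‖ (Eventually.of_forall fun x => ?_)
        simpa [Prod.norm_mk] using (by positivity : 0 ≤ ‖e‖ * ‖x‖ ^ (n + 1))
      refine (h.trans_isBigO hO).congr_left fun x => ?_
      have hv : ((x, T x + e * x ^ (n + 1)) - (x, T x) : ℂ × ℂ) = (e * x ^ (n + 1)) • (0, 1) := by
        ext <;> simp
      simp only [Function.comp_apply, hv, map_smul, smul_eq_mul, ← hldef]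
      ring
    have h2 : (fun x : ℂ => x ^ (n + 1) * (g x - g 0)) =o[𝓝 0] fun x => x ^ (n + 1) := by
      have : (fun x => g x - g 0) =o[𝓝 0] fun _ => (1 : ℂ) := by
        rw [Asymptotics.isLittleO_one_iff]
        simpa using hg.continuousAt.tendsto.sub_const (g 0)
      simpa using (Asymptotics.isBigO_refl (fun x : ℂ => x ^ (n + 1)) (𝓝 0)).mul_isLittleO this
    refine (h1.add h2).congr' ?_ EventuallyEq.rfl
    filter_upwards [hTg, hT.eventually_analyticAt] with x hx hTx
    have hd : deriv (fun x => T x + e * x ^ (n + 1)) x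
        = deriv T x + e * (((n + 1 : ℕ) : ℂ) * x ^ n) := by
      rw [deriv_fun_add hTx.differentiableAt (by fun_prop), deriv_const_mul_field, deriv_pow_field]
      simp
    have hge : g 0 = e * (((n + 1 : ℕ) : ℂ) - l) := by rw [he]; field_simp
    rw [hd, hge]
    linear_combination -hx

/-- **Briot–Bouquet theorem**: if `F (0, c) = 0` and `∂F/∂y (0, c)` is not a positive integer,
then `x φ' = F (x, φ)` has a holomorphic solution with `φ 0 = c`. -/
theorem exists_analyticAt_briotBouquet {F : ℂ × ℂ → ℂ} {c : ℂ} (hF : AnalyticAt ℂ F (0, c))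
    (hF0 : F (0, c) = 0) (hl : ∀ n : ℕ, 1 ≤ n → fderiv ℂ F (0, c) (0, 1) ≠ n) :
    ∃ φ : ℂ → ℂ, AnalyticAt ℂ φ 0 ∧ φ 0 = c ∧ ∀ᶠ x in 𝓝 0, x * deriv φ x = F (x, φ x) := by
  wlog hc : c = 0 generalizing F c
  · obtain ⟨φ, hφ, hφ0, h⟩ := this (F := fun z => F (z + (0, c))) (c := 0)
      (AnalyticAt.comp (g := F) (f := fun z : ℂ × ℂ => z + (0, c)) (by simpa using hF) (by fun_prop))
      (by simpa using hF0)
      (by rw [fderiv_comp_add_right]; simpa using hl) rfl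
    refine ⟨fun x => φ x + c, hφ.add analyticAt_const, by simp [hφ0], ?_⟩
    filter_upwards [h] with x hx
    rw [deriv_add_const]
    simpa using hx
  subst hc
  change AnalyticAt ℂ F 0 at hF
  change F 0 = 0 at hF0
  obtain ⟨K, s, hs, hK⟩ := hF.hasStrictFDerivAt.exists_lipschitzOnWith
  obtain ⟨r, hr, hrs⟩ := Metric.mem_nhds_iff.1
    (inter_mem hs (hF.eventually_analyticAt : {z | AnalyticAt ℂ F z} ∈ 𝓝 0))
  obtain ⟨N, hN⟩ := exists_nat_ge (2 * (K : ℝ))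
  obtain ⟨T, hT, hT0, g, hg, hTg⟩ := exists_approx_solution hF hF0 hl N
  set M := ‖g 0‖ + 1 with hM
  have hgM : ∀ᶠ x in 𝓝 (0 : ℂ), ‖g x‖ < M :=
    hg.continuousAt.norm.tendsto.eventually_lt_const (by simp [hM])
  have hsm : ∀ᶠ x in 𝓝 (0 : ℂ), ‖T x‖ + 2 * M * ‖x‖ ^ (N + 1) < r := by
    have : ContinuousAt (fun x : ℂ => ‖T x‖ + 2 * M * ‖x‖ ^ (N + 1)) 0 :=
      hT.continuousAt.norm.add (by fun_prop)
    exact this.tendsto.eventually_lt_const (by simpa [hT0] using hr)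
  obtain ⟨ρ, hρ, hball⟩ := Metric.eventually_nhds_iff_ball.1
    (((hTg.and hgM).and hsm).and hT.eventually_analyticAt)
  have hsub : Metric.ball (0 : ℂ) (min ρ r) ⊆ Metric.ball 0 ρ :=
    Metric.ball_subset_ball (min_le_left _ _)
  obtain ⟨φ, hφd, hφ0, hφ⟩ := exists_solution_of_approx (F := F) (r := r) (K := K) (N := N + 1)
    (T := T) (ρ := min ρ r) (M := M) (fun z hz => (hrs hz).2.differentiableAt)
    (hK.mono fun z hz => (hrs hz).1) hF0 (by omega) (by push_cast; linarith)
    (lt_min hρ hr) (min_le_right _ _) (by positivity)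
    (fun x hx => (hball x (hsub hx)).2.differentiableAt.differentiableWithinAt) hT0
    (fun x hx => by
      rw [(hball x (hsub hx)).1.1.1, norm_mul, norm_pow, mul_comm]
      gcongr
      exact (hball x (hsub hx)).1.1.2.le)
    (fun x hx => (hball x (hsub hx)).1.2)
  have hnhds : Metric.ball (0 : ℂ) (min ρ r) ∈ 𝓝 0 := Metric.ball_mem_nhds _ (lt_min hρ hr)
  exact ⟨φ, hφd.analyticAt hnhds, hφ0, by filter_upwards [hnhds] with x hx using hφ x hx⟩

lemma hasDerivAt_snd_slice {G : ℂ × ℂ → ℂ} {x t : ℂ} (hG : DifferentiableAt ℂ G (x, t)) :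
    HasDerivAt (fun s => G (x, s)) (fderiv ℂ G (x, t) (0, 1)) t :=
  HasFDerivAt.comp_hasDerivAt t hG.hasFDerivAt ((hasDerivAt_const t x).prodMk (hasDerivAt_id t))

lemma hasDerivAt_fst_slice {G : ℂ × ℂ → ℂ} {x t : ℂ} (hG : DifferentiableAt ℂ G (x, t)) :
    HasDerivAt (fun s => G (s, t)) (fderiv ℂ G (x, t) (1, 0)) x :=
  HasFDerivAt.comp_hasDerivAt x hG.hasFDerivAt ((hasDerivAt_id x).prodMk (hasDerivAt_const x t))

/-- A singular point `(0, c)` of `P dx + x Q dt` with `Q (0, c) ≠ 0` and no resonance carries an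
invariant graph `t = φ x`. -/
lemma exists_invariant_graph {P Q : ℂ × ℂ → ℂ} {c : ℂ} (hP : AnalyticAt ℂ P (0, c))
    (hQ : AnalyticAt ℂ Q (0, c)) (hP0 : P (0, c) = 0) (hQ0 : Q (0, c) ≠ 0)
    (hl : ∀ n : ℕ, 1 ≤ n → deriv (fun t => P (0, t)) c / -Q (0, c) ≠ n) :
    ∃ φ : ℂ → ℂ, AnalyticAt ℂ φ 0 ∧ φ 0 = c ∧
      ∀ᶠ x in 𝓝 (0 : ℂ), P (x, φ x) + (x * Q (x, φ x)) * deriv φ x = 0 := by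
  have hF : AnalyticAt ℂ (fun z => -P z / Q z) (0, c) := hP.neg.fun_div hQ hQ0
  obtain ⟨φ, hφ, hφ0, h⟩ := exists_analyticAt_briotBouquet hF (by simp [hP0]) fun n hn => by
    have h1 := hasDerivAt_snd_slice hF.differentiableAt
    have h2 := ((hasDerivAt_snd_slice hP.differentiableAt).neg).div
      (hasDerivAt_snd_slice hQ.differentiableAt) hQ0
    rw [h1.unique h2, ← (hasDerivAt_snd_slice hP.differentiableAt).deriv]
    convert hl n hn using 1
    simp only [Pi.neg_apply, hP0]
    field_simp
    ring
  refine ⟨φ, hφ, hφ0, ?_⟩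
  have hc : ContinuousAt (fun x => Q (x, φ x)) 0 :=
    ContinuousAt.comp (g := Q) (f := fun x => (x, φ x)) (by rw [hφ0]; exact hQ.continuousAt)
      (continuousAt_id.prodMk hφ.continuousAt)
  filter_upwards [h, hc.eventually_ne (by rw [hφ0]; exact hQ0)] with x hx hQx
  rw [mul_right_comm, hx]
  field_simp
  ring

/-- If `{l₁, l₂} = {u, v}` with `l₂ ≠ 0` and `l₁ / l₂` is not a positive rational, then `u` and
`v` are not both zero and `v / u` is not a positive integer. -/
lemma NotPosRat.of_same_eigenvalues {l₁ l₂ u v : ℂ} (hs : l₁ + l₂ = u + v) (hp : l₁ * l₂ = u * v)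
    (h₂ : l₂ ≠ 0) (h : NotPosRat (l₁ / l₂)) :
    (u = 0 → v ≠ 0) ∧ ∀ n : ℕ, 1 ≤ n → v / u ≠ n := by
  have hroot : (l₂ - u) * (l₂ - v) = 0 := by linear_combination l₂ * hs - hp
  rcases mul_eq_zero.1 hroot with h0 | h0
  · obtain rfl : l₂ = u := sub_eq_zero.1 h0
    obtain rfl : l₁ = v := by linear_combination hs
    refine ⟨fun h => absurd h h₂, fun n hn => ?_⟩
    simpa using h n (by exact_mod_cast hn)
  · obtain rfl : l₂ = v := sub_eq_zero.1 h0
    obtain rfl : l₁ = u := by linear_combination hs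
    refine ⟨fun _ => h₂, fun n hn hne => h (n : ℚ)⁻¹ (by positivity) ?_⟩
    rw [← inv_div, hne]
    simp

lemma SimpleSingPair.first_chart {P Q : ℂ × ℂ → ℂ} {c : ℂ} (hP : AnalyticAt ℂ P (0, c))
    (hQ : AnalyticAt ℂ Q (0, c)) (hP0 : P (0, c) = 0)
    (h : SimpleSingPair P (fun q => q.1 * Q q) (0, c)) :
    (-Q (0, c) = 0 → deriv (fun t => P (0, t)) c ≠ 0) ∧
      ∀ n : ℕ, 1 ≤ n → deriv (fun t => P (0, t)) c / -Q (0, c) ≠ n := by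
  obtain ⟨l₁, l₂, hs, hp, h₂, hr⟩ := h hP0 (by simp)
  have hB : DifferentiableAt ℂ (fun z : ℂ × ℂ => -(z.1 * Q z)) (0, c) :=
    (differentiableAt_fst.fun_mul hQ.differentiableAt).fun_neg
  have e1 : fderiv ℂ (fun z : ℂ × ℂ => -(z.1 * Q z)) (0, c) (1, 0) = -Q (0, c) := by
    refine (hasDerivAt_fst_slice hB).unique ?_
    simpa using ((hasDerivAt_id (0 : ℂ)).fun_mul (hasDerivAt_fst_slice hQ.differentiableAt)).fun_neg
  have e2 : fderiv ℂ (fun z : ℂ × ℂ => -(z.1 * Q z)) (0, c) (0, 1) = 0 := by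
    refine (hasDerivAt_snd_slice hB).unique ?_
    simpa using hasDerivAt_const c (0 : ℂ)
  rw [e1, ← (hasDerivAt_snd_slice hP.differentiableAt).deriv] at hs hp
  rw [e2, zero_mul, sub_zero] at hp
  exact hr.of_same_eigenvalues hs hp h₂

lemma SimpleSingPair.second_chart {C D : ℂ × ℂ → ℂ} (hC : AnalyticAt ℂ C (0, 0))
    (hD : AnalyticAt ℂ D (0, 0)) (hD0 : D (0, 0) = 0)
    (h : SimpleSingPair (fun q => q.2 * C q) D (0, 0)) :
    (C (0, 0) = 0 → deriv (fun s => D (s, 0)) 0 ≠ 0) ∧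
      ∀ n : ℕ, 1 ≤ n → deriv (fun s => D (s, 0)) 0 / -C (0, 0) ≠ n := by
  obtain ⟨l₁, l₂, hs, hp, h₂, hr⟩ := h (by simp) hD0
  have hB : DifferentiableAt ℂ (fun z : ℂ × ℂ => z.2 * C z) (0, 0) :=
    differentiableAt_snd.fun_mul hC.differentiableAt
  have e1 : fderiv ℂ (fun z : ℂ × ℂ => z.2 * C z) (0, 0) (0, 1) = C (0, 0) := by
    refine (hasDerivAt_snd_slice hB).unique ?_
    simpa using (hasDerivAt_id (0 : ℂ)).fun_mul (hasDerivAt_snd_slice hC.differentiableAt)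
  have e2 : fderiv ℂ (fun z : ℂ × ℂ => z.2 * C z) (0, 0) (1, 0) = 0 := by
    refine (hasDerivAt_fst_slice hB).unique ?_
    simpa using hasDerivAt_const (0 : ℂ) (0 : ℂ)
  have e3 : fderiv ℂ (fun z => -D z) (0, 0) (1, 0) = -deriv (fun s => D (s, 0)) 0 := by
    rw [(hasDerivAt_fst_slice hD.differentiableAt).deriv]
    exact (hasDerivAt_fst_slice hD.differentiableAt.fun_neg).unique
      (hasDerivAt_fst_slice hD.differentiableAt).fun_neg
  rw [e1, e3] at hs hp
  rw [e2, mul_zero, sub_zero] at hp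
  obtain ⟨h1, h3⟩ := hr.of_same_eigenvalues (u := C (0, 0)) (v := -deriv (fun s => D (s, 0)) 0)
    (by rw [hs, add_comm]) (by rw [hp, mul_comm]) h₂
  exact ⟨fun h => by simpa using h1 h, fun n hn => by rw [div_neg, ← neg_div]; exact h3 n hn⟩

/-- If the zeros of an entire function `p` are simple and are zeros of the entire function `q`,
then `q = h * p` for an entire function `h`. -/
lemma exists_entire_quotient {p q : ℂ → ℂ} (hp : Differentiable ℂ p) (hq : Differentiable ℂ q)
    (h : ∀ c, p c = 0 → q c = 0 ∧ deriv p c ≠ 0) :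
    ∃ f : ℂ → ℂ, Differentiable ℂ f ∧ ∀ t, q t = f t * p t := by
  classical
  refine ⟨fun t => if p t = 0 then deriv q t / deriv p t else q t / p t, fun c => ?_, fun t => ?_⟩
  · by_cases hc : p c = 0
    · obtain ⟨hqc, hpc⟩ := h c hc
      have hdp : DifferentiableAt ℂ (dslope p c) c :=
        ((Complex.differentiableOn_dslope univ_mem).2 hp.differentiableOn).differentiableAt univ_mem
      have hdq : DifferentiableAt ℂ (dslope q c) c :=
        ((Complex.differentiableOn_dslope univ_mem).2 hq.differentiableOn).differentiableAt univ_mem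
      have hne : dslope p c c ≠ 0 := by rwa [dslope_same]
      refine (hdq.fun_div hdp hne).congr_of_eventuallyEq ?_
      filter_upwards [hdp.continuousAt.eventually_ne hne] with t ht
      have ep : (t - c) * dslope p c t = p t := by simpa [hc] using sub_smul_dslope p c t
      have eq : (t - c) * dslope q c t = q t := by simpa [hqc] using sub_smul_dslope q c t
      by_cases htc : t = c
      · subst htc; simp [hc]
      · have hpt : p t ≠ 0 := by rw [← ep]; exact mul_ne_zero (sub_ne_zero.2 htc) ht
        rw [if_neg hpt, ← ep, ← eq, mul_div_mul_left _ _ (sub_ne_zero.2 htc)]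
    · refine ((hq c).fun_div (hp c) hc).congr_of_eventuallyEq ?_
      filter_upwards [(hp c).continuousAt.eventually_ne hc] with t ht
      rw [if_neg ht]
  · by_cases ht : p t = 0
    · simp [ht, (h t ht).1]
    · simp [ht]

/-- The index argument on `ℙ¹`: with `p t = t ^ (ν + 1) d(1/t)` and
`q t = t ^ ν (d(1/t) - e(1/t)/t)`, the total index `-1` prevents all indices from vanishing. -/
lemma not_all_indices_zero {p q d e : ℂ → ℂ} {ν : ℕ} (hp : Differentiable ℂ p)
    (hq : Differentiable ℂ q) (hd : DifferentiableAt ℂ d 0) (he : ContinuousAt e 0)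
    (hpd : ∀ t ≠ 0, p t = t ^ (ν + 1) * d t⁻¹)
    (hqd : ∀ t ≠ 0, q t = t ^ ν * (d t⁻¹ - t⁻¹ * e t⁻¹))
    (h : ∀ c, p c = 0 → q c = 0 ∧ deriv p c ≠ 0)
    (hinf : d 0 = 0 → e 0 = 0 ∧ deriv d 0 ≠ 0) : False := by
  obtain ⟨f, hf, hqf⟩ := exists_entire_quotient hp hq h
  have hdne : ∀ᶠ s in 𝓝[≠] (0 : ℂ), d s ≠ 0 := by
    by_cases h0 : d 0 = 0
    · have := hd.hasDerivAt.eventually_ne (c := 0) (hinf h0).2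
      simpa [h0] using this
    · exact nhdsWithin_le_nhds (hd.continuousAt.eventually_ne h0)
  obtain ⟨L, hL⟩ : ∃ L, Tendsto (fun s => s / d s) (𝓝[≠] 0) (𝓝 L) := by
    by_cases h0 : d 0 = 0
    · refine ⟨(deriv d 0)⁻¹, ?_⟩
      have h1 := (hasDerivAt_iff_tendsto_slope.1 hd.hasDerivAt).inv₀ (hinf h0).2
      refine h1.congr fun s => ?_
      simp [slope_def_field, h0]
    · exact ⟨0 / d 0, (continuousAt_id.div hd.continuousAt h0).tendsto.mono_left
        nhdsWithin_le_nhds⟩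
  have hid : Tendsto (fun s : ℂ => s) (𝓝[≠] 0) (𝓝 0) := nhdsWithin_le_nhds
  have hlim : Tendsto (fun s : ℂ => s - s * (s / d s) * e s) (𝓝[≠] 0) (𝓝 0) := by
    have := hid.sub ((hid.mul hL).mul (he.tendsto.mono_left nhdsWithin_le_nhds))
    simpa using this
  have hf0 : Tendsto f (cocompact ℂ) (𝓝 0) := by
    rw [← Metric.cobounded_eq_cocompact]
    refine (hlim.comp tendsto_inv₀_cobounded').congr' ?_
    filter_upwards [tendsto_inv₀_cobounded'.eventually hdne,
      tendsto_inv₀_cobounded'.eventually self_mem_nhdsWithin] with t ht ht0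
    have ht0' : t ≠ 0 := by simpa using ht0
    have hpt : p t ≠ 0 := by rw [hpd t ht0']; positivity
    have e1 : f t = q t / p t := by rw [hqf t]; field_simp
    rw [e1, hqd t ht0', hpd t ht0']
    simp only [Function.comp_apply]
    generalize d t⁻¹ = d₁ at ht
    generalize e t⁻¹ = e₁
    field_simp
    ring
  have hq0 : ∀ t, q t = 0 := fun t => by rw [hqf, hf.apply_eq_of_tendsto_cocompact t hf0, zero_mul]
  have hde : ∀ s ≠ 0, d s = s * e s := by
    intro s hs
    have h1 := hqd s⁻¹ (inv_ne_zero hs)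
    rw [hq0, inv_inv] at h1
    have h2 := (mul_eq_zero.1 h1.symm).resolve_left (by positivity)
    linear_combination h2
  have hd0 : d 0 = 0 := by
    refine tendsto_nhds_unique (hd.continuousAt.tendsto.mono_left
      (nhdsWithin_le_nhds (s := {0}ᶜ))) ?_
    have h1 := hid.mul (he.tendsto.mono_left (nhdsWithin_le_nhds (s := {0}ᶜ)))
    rw [zero_mul] at h1
    refine h1.congr' ?_
    filter_upwards [self_mem_nhdsWithin] with s hs using (hde s hs).symm
  obtain ⟨he0, hd'⟩ := hinf hd0
  refine hd' (tendsto_nhds_unique (hasDerivAt_iff_tendsto_slope.1 hd.hasDerivAt) ?_)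
  have h1 := he.tendsto.mono_left (nhdsWithin_le_nhds (s := {0}ᶜ))
  rw [he0] at h1
  refine h1.congr' ?_
  filter_upwards [self_mem_nhdsWithin] with s hs
  have hs0 : s ≠ 0 := hs
  rw [slope_def_field, hd0, hde s hs, sub_zero, sub_zero]
  field_simp

/-- Let `𝓖 = π⋆𝓕` be the strict transform, under the blow-up `π` of the
origin, of a non-dicritical foliation `ω = a dx + b dy` of multiplicity `ν`, so that the
exceptional divisor `E ≅ ℙ¹` (of self-intersection `−1`) is invariant; write `𝓖` in the two
charts as in the Camacho–Sad index theorem (`P dx + x·Q dt` and `y·C ds + D dy`). If every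
singularity of `𝓖` on `E` is simple, then at least one singular point of `𝓖` on `E`
carries a separatrix of `𝓖` transverse to `E`: an invariant graph `t = φ(x)` through some
singular point `(0,c)` in the first chart, or an invariant graph `s = ψ(y)` through the
point at infinity of `E` in the second chart. -/
theorem simple_singularities_on_exceptional_give_transverse_separatrix
    (U : Set (ℂ × ℂ)) (hU : U ∈ 𝓝 (0 : ℂ × ℂ))
    (a b : ℂ × ℂ → ℂ) (ha : AnalyticOnNhd ℂ a U) (hb : AnalyticOnNhd ℂ b U)
    (ν : ℕ)
    (hν : ∀ i j : ℕ, i + j < ν → taylorCoeff a i j = 0 ∧ taylorCoeff b i j = 0)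
    (hνmin : ∃ i j : ℕ, i + j = ν ∧ (taylorCoeff a i j ≠ 0 ∨ taylorCoeff b i j ≠ 0))
    (hnondic : ¬ ∀ i j : ℕ, i + j = ν + 1 →
      (if i = 0 then 0 else taylorCoeff a (i - 1) j) +
      (if j = 0 then 0 else taylorCoeff b i (j - 1)) = 0)
    (P Q : ℂ × ℂ → ℂ)
    (hP : AnalyticOnNhd ℂ P {q : ℂ × ℂ | (q.1, q.1 * q.2) ∈ U})
    (hQ : AnalyticOnNhd ℂ Q {q : ℂ × ℂ | (q.1, q.1 * q.2) ∈ U})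
    (hPe : ∀ q : ℂ × ℂ, (q.1, q.1 * q.2) ∈ U →
      q.1 ^ ν * P q = a (q.1, q.1 * q.2) + q.2 * b (q.1, q.1 * q.2))
    (hQe : ∀ q : ℂ × ℂ, (q.1, q.1 * q.2) ∈ U →
      q.1 ^ ν * Q q = b (q.1, q.1 * q.2))
    (C D : ℂ × ℂ → ℂ)
    (hC : AnalyticOnNhd ℂ C {q : ℂ × ℂ | (q.1 * q.2, q.2) ∈ U})
    (hD : AnalyticOnNhd ℂ D {q : ℂ × ℂ | (q.1 * q.2, q.2) ∈ U})
    (hCe : ∀ q : ℂ × ℂ, (q.1 * q.2, q.2) ∈ U →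
      q.2 ^ ν * C q = a (q.1 * q.2, q.2))
    (hDe : ∀ q : ℂ × ℂ, (q.1 * q.2, q.2) ∈ U →
      q.2 ^ ν * D q = q.1 * a (q.1 * q.2, q.2) + b (q.1 * q.2, q.2))
    (hsimple₁ : ∀ c : ℂ, SimpleSingPair P (fun q => q.1 * Q q) (0, c))
    (hsimple₂ : SimpleSingPair (fun q => q.2 * C q) D (0, 0)) :
    (∃ c : ℂ, P (0, c) = 0 ∧
      ∃ φ : ℂ → ℂ, AnalyticAt ℂ φ 0 ∧ φ 0 = c ∧
        ∀ᶠ x in 𝓝 (0 : ℂ),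
          P (x, φ x) + (x * Q (x, φ x)) * deriv φ x = 0) ∨
    (D (0, 0) = 0 ∧
      ∃ ψ : ℂ → ℂ, AnalyticAt ℂ ψ 0 ∧ ψ 0 = 0 ∧
        ∀ᶠ y in 𝓝 (0 : ℂ),
          (y * C (ψ y, y)) * deriv ψ y + D (ψ y, y) = 0) := by
  have hmem : ((0 : ℂ), (0 : ℂ)) ∈ U := mem_of_mem_nhds hU
  have hPan : ∀ t, AnalyticAt ℂ P (0, t) := fun t => hP _ (by simpa using hmem)
  have hQan : ∀ t, AnalyticAt ℂ Q (0, t) := fun t => hQ _ (by simpa using hmem)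
  have hCan : ∀ s, AnalyticAt ℂ C (s, 0) := fun s => hC _ (by simpa using hmem)
  have hDan : ∀ s, AnalyticAt ℂ D (s, 0) := fun s => hD _ (by simpa using hmem)
  have hchange : ∀ t ≠ 0, ∀ᶠ x in 𝓝[≠] (0 : ℂ),
      P (x, t) = t ^ (ν + 1) * D (t⁻¹, x * t) ∧
      Q (x, t) = t ^ ν * (D (t⁻¹, x * t) - t⁻¹ * C (t⁻¹, x * t)) := by
    intro t ht
    have hUx : ∀ᶠ x in 𝓝 (0 : ℂ), (x, x * t) ∈ U := by
      have hc : ContinuousAt (fun x : ℂ => (x, x * t)) 0 := by fun_prop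
      exact hc.tendsto.eventually (by rw [zero_mul]; exact hU)
    filter_upwards [nhdsWithin_le_nhds hUx, self_mem_nhdsWithin] with x hx hx0
    have hxν : x ^ ν ≠ 0 := pow_ne_zero _ hx0
    have hst : t⁻¹ * (x * t) = x := by field_simp
    have h1 := hPe (x, t) hx
    have h2 := hQe (x, t) hx
    have h3 := hCe (t⁻¹, x * t) (by simpa only [hst] using hx)
    have h4 := hDe (t⁻¹, x * t) (by simpa only [hst] using hx)
    simp only [hst, mul_pow] at h1 h2 h3 h4
    have htt : t * t⁻¹ = 1 := mul_inv_cancel₀ ht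
    constructor
    · refine mul_left_cancel₀ hxν ?_
      rw [pow_succ]
      linear_combination h1 - t * h4 - a (x, x * t) * htt
    · refine mul_left_cancel₀ hxν ?_
      linear_combination h2 - h4 + t⁻¹ * h3
  have hid : Tendsto (fun x : ℂ => x) (𝓝[≠] 0) (𝓝 0) := nhdsWithin_le_nhds
  have hfst : ∀ (G : ℂ × ℂ → ℂ) (t : ℂ), AnalyticAt ℂ G (0, t) →
      Tendsto (fun x => G (x, t)) (𝓝[≠] 0) (𝓝 (G (0, t))) := fun G t hG =>
    hG.continuousAt.tendsto.comp (hid.prodMk_nhds tendsto_const_nhds)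
  have hsnd : ∀ (G : ℂ × ℂ → ℂ) (s t : ℂ), AnalyticAt ℂ G (s, 0) →
      Tendsto (fun x => G (s, x * t)) (𝓝[≠] 0) (𝓝 (G (s, 0))) := fun G s t hG =>
    hG.continuousAt.tendsto.comp
      (tendsto_const_nhds.prodMk_nhds (by simpa using hid.mul_const t))
  have hpd : ∀ t ≠ 0, P (0, t) = t ^ (ν + 1) * D (t⁻¹, 0) := fun t ht =>
    tendsto_nhds_unique (hfst P t (hPan t)) (((hsnd D t⁻¹ t (hDan _)).const_mul _).congr'
      ((hchange t ht).mono fun x hx => hx.1.symm))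
  have hqd : ∀ t ≠ 0, Q (0, t) = t ^ ν * (D (t⁻¹, 0) - t⁻¹ * C (t⁻¹, 0)) := fun t ht =>
    tendsto_nhds_unique (hfst Q t (hQan t)) ((((hsnd D t⁻¹ t (hDan _)).sub
      ((hsnd C t⁻¹ t (hCan _)).const_mul _)).const_mul _).congr'
      ((hchange t ht).mono fun x hx => hx.2.symm))
  by_contra hcon
  rw [not_or] at hcon
  obtain ⟨hcon₁, hcon₂⟩ := hcon
  refine not_all_indices_zero (p := fun t => P (0, t)) (q := fun t => Q (0, t))
    (d := fun s => D (s, 0)) (e := fun s => C (s, 0)) (ν := ν)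
    (fun t => (hasDerivAt_snd_slice (hPan t).differentiableAt).differentiableAt)
    (fun t => (hasDerivAt_snd_slice (hQan t).differentiableAt).differentiableAt)
    (hasDerivAt_fst_slice (hDan 0).differentiableAt).differentiableAt
    (hasDerivAt_fst_slice (hCan 0).differentiableAt).continuousAt hpd hqd ?_ ?_
  · intro c hc
    obtain ⟨h1, h2⟩ := (hsimple₁ c).first_chart (hPan c) (hQan c) hc
    have hQ0 : Q (0, c) = 0 := by
      by_contra hQ0
      exact hcon₁ ⟨c, hc, exists_invariant_graph (hPan c) (hQan c) hc hQ0 h2⟩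
    exact ⟨hQ0, h1 (by simpa using hQ0)⟩
  · intro hD0
    obtain ⟨h1, h2⟩ := hsimple₂.second_chart (hCan 0) (hDan 0) hD0
    have hC0 : C (0, 0) = 0 := by
      by_contra hC0
      obtain ⟨ψ, hψ, hψ0, h⟩ := exists_invariant_graph (P := fun z => D (z.2, z.1))
        (Q := fun z => C (z.2, z.1)) (c := 0)
        (AnalyticAt.comp₂ (hDan 0) analyticAt_snd analyticAt_fst)
        (AnalyticAt.comp₂ (hCan 0) analyticAt_snd analyticAt_fst) hD0 hC0 h2
      exact hcon₂ ⟨hD0, ψ, hψ, hψ0, h.mono fun y hy => by rw [add_comm]; exact hy⟩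
    exact ⟨hC0, h1 hC0⟩
end
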